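/- There is a constant b₀ > 0 such that for every λ > 0 and every finite connected transitive graph 𝔾 satisfying the triangle condition ∇_{p_c}(x,y) ≤ δ_{x,y} + a₀ with a₀ ≤ b₀ and λV^{1/3} ≥ b₀^{-1}, the following holds: for p = p_c + εΩ^{-1} with ε ≥ 0 (and p ≤ 1), the susceptibility satisfies χ(p) ≤ 81(V^{1/3} + ε²V). -/

import Mathlib

noncomputable section
open Classical

namespace Percolation

variable {V : Type*} [Fintype V] [DecidableEq V]

/-- A percolation configuration: an assignment of occupied (`true`) or
vacant (`false`) to each bond of the graph. -/
def Config (G : SimpleGraph V) : Type _ := G.edgeSet → Bool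

noncomputable instance (G : SimpleGraph V) : Fintype G.edgeSet :=
  Fintype.ofFinite _

noncomputable instance (G : SimpleGraph V) : Fintype (Config G) :=
  inferInstanceAs (Fintype (G.edgeSet → Bool))

/-- The probability weight of a configuration under the product Bernoulli
measure with parameter `p`. -/
def weight (G : SimpleGraph V) (p : ℝ) (ω : Config G) : ℝ :=
  ∏ e : G.edgeSet, if ω e then p else 1 - p

/-- The probability of an event under the percolation measure `ℙ_p`. -/
def prob (G : SimpleGraph V) (p : ℝ) (A : Config G → Prop) : ℝ :=
  ∑ ω : Config G, if A ω then weight G p ω else 0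

/-- The expectation of a random variable under the percolation measure `ℙ_p`. -/
def expect (G : SimpleGraph V) (p : ℝ) (f : Config G → ℝ) : ℝ :=
  ∑ ω : Config G, weight G p ω * f ω

/-- The subgraph consisting of the occupied bonds of a configuration. -/
def occupied (G : SimpleGraph V) (ω : Config G) : SimpleGraph V :=
  SimpleGraph.fromEdgeSet {e | ∃ h : e ∈ G.edgeSet, ω ⟨e, h⟩ = true}

/-- The cluster `C(x)` of the vertex `x`: all vertices joined to `x` by a path
of occupied bonds (including `x` itself). -/
def cluster (G : SimpleGraph V) (ω : Config G) (x : V) : Finset V :=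
  Finset.univ.filter fun y => (occupied G ω).Reachable x y

/-- The susceptibility `χ(p)`: the expected size of the cluster of `x₀`. -/
def chi (G : SimpleGraph V) (x₀ : V) (p : ℝ) : ℝ :=
  expect G p fun ω => ((cluster G ω x₀).card : ℝ)

/-- The two-point function `τ_p(x,y) = ℙ_p(x ↔ y)`. -/
def tau (G : SimpleGraph V) (p : ℝ) (x y : V) : ℝ :=
  prob G p fun ω => (occupied G ω).Reachable x y

/-- The triangle diagram `∇_p(x,y)`. -/
def triangle (G : SimpleGraph V) (p : ℝ) (x y : V) : ℝ :=
  ∑ u : V, ∑ v : V, tau G p x u * tau G p u v * tau G p v y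

/-- The Kronecker delta `δ_{x,y}`. -/
def kron (x y : V) : ℝ := if x = y then 1 else 0

/-- `∇̄_p`: the maximum of the triangle diagram over bonds `{x,y} ∈ 𝔹`. -/
def nablaBar (G : SimpleGraph V) (p : ℝ) : ℝ :=
  sSup {t : ℝ | ∃ x y : V, G.Adj x y ∧ t = triangle G p x y}

/-- A graph is (vertex-)transitive if any vertex can be mapped to any other
by a graph automorphism. -/
def IsTransitive (G : SimpleGraph V) : Prop :=
  ∀ x y : V, ∃ φ : G ≃g G, φ x = y

/-- The size `|C_max|` of the largest cluster. -/
def maxCluster (G : SimpleGraph V) (ω : Config G) : ℕ :=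
  Finset.univ.sup fun x => (cluster G ω x).card

/-- The cluster size distribution `P_{≥k}(p) = ℙ_p(|C(x₀)| ≥ k)`. -/
def Pgeq (G : SimpleGraph V) (x₀ : V) (p : ℝ) (k : ℝ) : ℝ :=
  prob G p fun ω => k ≤ ((cluster G ω x₀).card : ℝ)

/-- The magnetization `M(p,γ)`. -/
def magnetization (G : SimpleGraph V) (x₀ : V) (p γ : ℝ) : ℝ :=
  ∑ k ∈ Finset.Icc 1 (Fintype.card V),
    (1 - (1 - γ) ^ k) * prob G p fun ω => (cluster G ω x₀).card = k

/-- `Z_{≥s}`: the number of vertices lying in clusters of size at least `s`. -/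
def Zgeq (G : SimpleGraph V) (s : ℝ) (ω : Config G) : ℝ :=
  ∑ x : V, if s ≤ ((cluster G ω x).card : ℝ) then (1 : ℝ) else 0

/-- The variance of a random variable under `ℙ_p`. -/
def variance (G : SimpleGraph V) (p : ℝ) (f : Config G → ℝ) : ℝ :=
  expect G p (fun ω => f ω ^ 2) - (expect G p f) ^ 2

/-- The restricted susceptibility `χ_{≥s}(p) = 𝔼_p[|C(x₀)| I[|C(x₀)| ≥ s]]`. -/
def chiGeq (G : SimpleGraph V) (x₀ : V) (p : ℝ) (s : ℝ) : ℝ :=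
  expect G p fun ω =>
    if s ≤ ((cluster G ω x₀).card : ℝ) then ((cluster G ω x₀).card : ℝ) else 0

/-- The restricted susceptibility `χ_{<s}(p) = 𝔼_p[|C(x₀)| I[|C(x₀)| < s]]`. -/
def chiLt (G : SimpleGraph V) (x₀ : V) (p : ℝ) (s : ℝ) : ℝ :=
  expect G p fun ω =>
    if ((cluster G ω x₀).card : ℝ) < s then ((cluster G ω x₀).card : ℝ) else 0

end Percolation

namespace PercAux

/-- Expectation of `f S` where `S` is a random subset of `I`, each element kept with
probability `p`. -/
def Ex {α : Type*} (I : Finset α) (p : ℝ) (f : Finset α → ℝ) : ℝ :=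
  ∑ S ∈ I.powerset, p ^ S.card * (1 - p) ^ (I.card - S.card) * f S

/-- Indicator. -/
def ind (P : Prop) : ℝ := if P then 1 else 0

lemma ind_nonneg (P : Prop) : 0 ≤ ind P := by unfold ind; split_ifs <;> norm_num
lemma ind_le_one (P : Prop) : ind P ≤ 1 := by unfold ind; split_ifs <;> norm_num
lemma ind_true {P : Prop} (h : P) : ind P = 1 := by simp [ind, h]
lemma ind_false {P : Prop} (h : ¬ P) : ind P = 0 := by simp [ind, h]
lemma ind_mono {P Q : Prop} (h : P → Q) : ind P ≤ ind Q := by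
  by_cases hP : P
  · rw [ind_true hP, ind_true (h hP)]
  · rw [ind_false hP]; exact ind_nonneg Q

section basic
variable {α : Type*}

lemma Ex_empty (p : ℝ) (f : Finset α → ℝ) : Ex ∅ p f = f ∅ := by simp [Ex]

lemma Ex_insert {a : α} {I : Finset α} (ha : a ∉ I) (p : ℝ) (f : Finset α → ℝ) :
    Ex (insert a I) p f = (1 - p) * Ex I p f + p * Ex I p (fun S => f (insert a S)) := by
  unfold Ex
  rw [Finset.sum_powerset_insert ha, Finset.mul_sum, Finset.mul_sum]
  congr 1
  · apply Finset.sum_congr rfl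
    intro S hS
    have h1 := Finset.card_le_card (Finset.mem_powerset.1 hS)
    rw [Finset.card_insert_of_notMem ha, Nat.succ_sub h1, pow_succ]; ring
  · apply Finset.sum_congr rfl
    intro S hS
    have h1 : a ∉ S := fun h => ha (Finset.mem_powerset.1 hS h)
    rw [Finset.card_insert_of_notMem ha, Finset.card_insert_of_notMem h1, Nat.add_sub_add_right,
      pow_succ]; ring

lemma Ex_congr {I : Finset α} {p : ℝ} {f g : Finset α → ℝ} (h : ∀ S, S ⊆ I → f S = g S) :
    Ex I p f = Ex I p g := by
  unfold Ex
  apply Finset.sum_congr rfl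
  intro S hS
  rw [h S (Finset.mem_powerset.1 hS)]

lemma Ex_add (I : Finset α) (p : ℝ) (f g : Finset α → ℝ) :
    Ex I p (fun S => f S + g S) = Ex I p f + Ex I p g := by
  unfold Ex
  rw [← Finset.sum_add_distrib]
  exact Finset.sum_congr rfl fun S _ => by ring

lemma Ex_sub (I : Finset α) (p : ℝ) (f g : Finset α → ℝ) :
    Ex I p (fun S => f S - g S) = Ex I p f - Ex I p g := by
  unfold Ex
  rw [← Finset.sum_sub_distrib]
  exact Finset.sum_congr rfl fun S _ => by ring

lemma Ex_const_mul (I : Finset α) (p c : ℝ) (f : Finset α → ℝ) :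
    Ex I p (fun S => c * f S) = c * Ex I p f := by
  unfold Ex
  rw [Finset.mul_sum]
  exact Finset.sum_congr rfl fun S _ => by ring

lemma Ex_mul_const (I : Finset α) (p c : ℝ) (f : Finset α → ℝ) :
    Ex I p (fun S => f S * c) = Ex I p f * c := by
  unfold Ex
  rw [Finset.sum_mul]
  exact Finset.sum_congr rfl fun S _ => by ring

lemma Ex_sum {ι : Type*} (I : Finset α) (p : ℝ) (s : Finset ι) (f : ι → Finset α → ℝ) :
    Ex I p (fun S => ∑ i ∈ s, f i S) = ∑ i ∈ s, Ex I p (f i) := by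
  unfold Ex
  rw [Finset.sum_comm]
  exact Finset.sum_congr rfl fun S _ => by rw [Finset.mul_sum]

lemma Ex_const (I : Finset α) (p c : ℝ) : Ex I p (fun _ => c) = c := by
  induction I using Finset.induction_on with
  | empty => exact Ex_empty _ _
  | insert a I ha ih => rw [Ex_insert ha, ih]; ring

lemma Ex_mono {I : Finset α} {p : ℝ} (h0 : 0 ≤ p) (h1 : p ≤ 1) {f g : Finset α → ℝ}
    (h : ∀ S, S ⊆ I → f S ≤ g S) : Ex I p f ≤ Ex I p g := by
  unfold Ex
  apply Finset.sum_le_sum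
  intro S hS
  have h2 := h S (Finset.mem_powerset.1 hS)
  have : 0 ≤ 1 - p := by linarith
  gcongr

lemma Ex_nonneg {I : Finset α} {p : ℝ} (h0 : 0 ≤ p) (h1 : p ≤ 1) {f : Finset α → ℝ}
    (h : ∀ S, S ⊆ I → 0 ≤ f S) : 0 ≤ Ex I p f := by
  have := Ex_mono (I := I) h0 h1 (f := fun _ => 0) (g := f) h
  rwa [Ex_const] at this

lemma Ex_zero (I : Finset α) (f : Finset α → ℝ) : Ex I 0 f = f ∅ := by
  induction I using Finset.induction_on with
  | empty => exact Ex_empty _ _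
  | insert a I ha ih => rw [Ex_insert ha, ih]; ring

lemma Ex_comm {β : Type*} (I : Finset α) (J : Finset β) (p q : ℝ)
    (f : Finset α → Finset β → ℝ) :
    Ex I p (fun S => Ex J q (fun T => f S T)) = Ex J q (fun T => Ex I p (fun S => f S T)) := by
  unfold Ex
  simp_rw [Finset.mul_sum]
  rw [Finset.sum_comm]
  exact Finset.sum_congr rfl fun S _ => Finset.sum_congr rfl fun T _ => by ring

lemma Ex_filter (P : α → Prop) (I : Finset α) (p : ℝ) :
    ∀ g : Finset α → ℝ, Ex I p (fun S => g (S.filter P)) = Ex (I.filter P) p g := by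
  induction I using Finset.induction_on with
  | empty => intro g; simp [Ex_empty]
  | insert a I ha ih =>
    intro g
    rw [Ex_insert ha]
    by_cases hP : P a
    · simp only [Finset.filter_insert, hP, if_true]
      rw [Ex_insert (by simp [ha]), ih g, ih (fun S => g (insert a S))]
    · simp only [Finset.filter_insert, hP, if_false]
      rw [ih g]; ring

lemma Ex_indep (P : α → Prop) (I : Finset α) (p : ℝ) :
    ∀ f g : Finset α → ℝ, Ex I p (fun S => f (S.filter P) * g (S.filter (fun a => ¬ P a))) =
      Ex I p (fun S => f (S.filter P)) * Ex I p (fun S => g (S.filter (fun a => ¬ P a))) := by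
  induction I using Finset.induction_on with
  | empty => intro f g; simp [Ex_empty]
  | insert a I ha ih =>
    intro f g
    simp only [Ex_insert ha]
    by_cases hP : P a
    · simp only [Finset.filter_insert, hP, if_true, not_true_eq_false, if_false]
      rw [ih f g, ih (fun S => f (insert a S)) g]; ring
    · simp only [Finset.filter_insert, hP, if_false, not_false_eq_true, if_true]
      rw [ih f g, ih f (fun S => g (insert a S))]; ring

lemma Ex_merge (I : Finset α) (p q : ℝ) :
    ∀ f : Finset α → ℝ, Ex I p (fun S => Ex I q (fun T => f (S ∪ T))) =
      Ex I (p + q - p * q) f := by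
  induction I using Finset.induction_on with
  | empty => intro f; simp [Ex_empty]
  | insert a I ha ih =>
    intro f
    simp only [Ex_insert ha, Finset.insert_union, Finset.union_insert, Finset.insert_idem]
    simp only [Ex_add, Ex_const_mul]
    rw [ih f, ih (fun S => f (insert a S))]
    ring

/-- Disjoint occurrence. -/
def Box (A B : Finset α → Prop) (S : Finset α) : Prop :=
  ∃ K L, K ⊆ S ∧ L ⊆ S ∧ Disjoint K L ∧ A K ∧ B L

def Inc (A : Finset α → Prop) : Prop := ∀ S S', S ⊆ S' → A S → A S'

lemma Box_inc {A B : Finset α → Prop} : Inc (Box A B) := by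
  rintro S S' h ⟨K, L, h1, h2, h3⟩
  exact ⟨K, L, h1.trans h, h2.trans h, h3⟩

lemma Box_mono {A A' B B' : Finset α → Prop} (hA : ∀ S, A S → A' S) (hB : ∀ S, B S → B' S)
    {S : Finset α} : Box A B S → Box A' B' S := by
  rintro ⟨K, L, h1, h2, h3, h4, h5⟩
  exact ⟨K, L, h1, h2, h3, hA _ h4, hB _ h5⟩

lemma Box_insert {A B : Finset α → Prop} (hA : Inc A) (hB : Inc B) (a : α) (S : Finset α)
    (ha : a ∉ S) (h : Box A B (insert a S)) :
    Box (fun S => A (insert a S)) B S ∨ Box A (fun S => B (insert a S)) S := by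
  obtain ⟨K, L, h1, h2, h3, h4, h5⟩ := h
  by_cases hK : a ∈ K
  · left
    have hL : a ∉ L := fun h => (Finset.disjoint_left.1 h3 hK h)
    refine ⟨K.erase a, L, ?_, ?_, ?_, ?_, h5⟩
    · rwa [← Finset.subset_insert_iff]
    · exact (Finset.subset_insert_iff_of_notMem hL).1 h2
    · exact h3.mono_left (Finset.erase_subset _ _)
    · simpa [Finset.insert_erase hK] using h4
  · right
    refine ⟨K, L.erase a, ?_, ?_, ?_, h4, ?_⟩
    · exact (Finset.subset_insert_iff_of_notMem hK).1 h1
    · rwa [← Finset.subset_insert_iff]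
    · exact h3.mono_right (Finset.erase_subset _ _)
    · exact hB _ _ (Finset.insert_erase_subset a L |> fun _ => by
        intro x hx; by_cases hxa : x = a
        · simp [hxa]
        · simp [hxa, hx]) h5

/-- The van den Berg–Kesten inequality for increasing events (with `p ≤ 1/2`). -/
lemma BK (I : Finset α) {p : ℝ} (h0 : 0 ≤ p) (h1 : p ≤ 1 / 2) :
    ∀ A B : Finset α → Prop, Inc A → Inc B →
      Ex I p (fun S => ind (Box A B S)) ≤
        Ex I p (fun S => ind (A S)) * Ex I p (fun S => ind (B S)) := by
  induction I using Finset.induction_on with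
  | empty =>
    intro A B hA hB
    simp only [Ex_empty]
    by_cases h : Box A B ∅
    · obtain ⟨K, L, k1, k2, k3, k4, k5⟩ := h
      rw [ind_true (hA _ _ k1 k4), ind_true (hB _ _ k2 k5)]
      simpa using ind_le_one _
    · rw [ind_false h]; exact mul_nonneg (ind_nonneg _) (ind_nonneg _)
  | insert a I ha ih =>
    intro A B hA hB
    have hp1 : p ≤ 1 := by linarith
    set A' : Finset α → Prop := fun S => A (insert a S) with hA'
    set B' : Finset α → Prop := fun S => B (insert a S) with hB'
    have iA' : Inc A' := fun S S' h h2 => hA _ _ (Finset.insert_subset_insert a h) h2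
    have iB' : Inc B' := fun S S' h h2 => hB _ _ (Finset.insert_subset_insert a h) h2
    have mA : ∀ S, A S → A' S := fun S h => hA _ _ (Finset.subset_insert a S) h
    have mB : ∀ S, B S → B' S := fun S h => hB _ _ (Finset.subset_insert a S) h
    have e1 : Ex I p (fun S => ind (Box A B (insert a S))) ≤
        Ex I p (fun S => ind (Box A' B S)) + Ex I p (fun S => ind (Box A B' S))
          - Ex I p (fun S => ind (Box A B S)) := by
      rw [← Ex_add, ← Ex_sub]
      apply Ex_mono h0 hp1
      intro S hS
      have haS : a ∉ S := fun h => ha (hS h)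
      by_cases hb : Box A B S
      · rw [ind_true hb, ind_true (Box_mono mA (fun _ h => h) hb : Box A' B S),
          ind_true (Box_mono (fun _ h => h) mB hb : Box A B' S)]
        have := ind_le_one (Box A B (insert a S)); linarith
      · rw [ind_false hb]
        by_cases hc : Box A B (insert a S)
        · rcases Box_insert hA hB a S haS hc with h | h
          · have h' : ind (Box A' B S) = 1 := ind_true h
            rw [h']
            have := ind_le_one (Box A B (insert a S)); have := ind_nonneg (Box A B' S); linarith
          · have h' : ind (Box A B' S) = 1 := ind_true h
            rw [h']
            have := ind_le_one (Box A B (insert a S)); have := ind_nonneg (Box A' B S); linarith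
        · rw [ind_false hc]
          have := ind_nonneg (Box A B' S); have := ind_nonneg (Box A' B S); linarith
    have i1 := ih A B hA hB
    have i2 := ih A' B iA' hB
    have i3 := ih A B' hA iB'
    have a1 : Ex I p (fun S => ind (A S)) ≤ Ex I p (fun S => ind (A' S)) :=
      Ex_mono h0 hp1 fun S _ => ind_mono (mA S)
    have b1 : Ex I p (fun S => ind (B S)) ≤ Ex I p (fun S => ind (B' S)) :=
      Ex_mono h0 hp1 fun S _ => ind_mono (mB S)
    rw [Ex_insert ha, Ex_insert ha, Ex_insert ha]
    change _ ≤ ((1 - p) * Ex I p (fun S => ind (A S)) + p * Ex I p (fun S => ind (A' S))) *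
      ((1 - p) * Ex I p (fun S => ind (B S)) + p * Ex I p (fun S => ind (B' S)))
    generalize Ex I p (fun S => ind (Box A B (insert a S))) = z at *
    generalize Ex I p (fun S => ind (Box A B S)) = x at *
    generalize Ex I p (fun S => ind (Box A' B S)) = x1 at *
    generalize Ex I p (fun S => ind (Box A B' S)) = x2 at *
    generalize Ex I p (fun S => ind (A S)) = s at *
    generalize Ex I p (fun S => ind (A' S)) = s' at *
    generalize Ex I p (fun S => ind (B S)) = t at *
    generalize Ex I p (fun S => ind (B' S)) = t' at *
    have k1 : p * z ≤ p * (s' * t + s * t' - x) := mul_le_mul_of_nonneg_left (by linarith) h0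
    have k2 : (1 - 2 * p) * x ≤ (1 - 2 * p) * (s * t) :=
      mul_le_mul_of_nonneg_left i1 (by linarith)
    have k3 : 0 ≤ p ^ 2 * ((s' - s) * (t' - t)) :=
      mul_nonneg (sq_nonneg p) (mul_nonneg (by linarith) (by linarith))
    nlinarith

lemma Ex_map {β : Type*} (e : α ↪ β) (I : Finset α) (p : ℝ) :
    ∀ f : Finset β → ℝ, Ex (I.map e) p f = Ex I p (fun S => f (S.map e)) := by
  induction I using Finset.induction_on with
  | empty => intro f; simp [Ex_empty]
  | insert a I ha ih =>
    intro f
    rw [Finset.map_insert, Ex_insert (by simpa using ha), Ex_insert ha, ih f,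
      ih (fun S => f (insert (e a) S))]
    simp only [Finset.map_insert]

/-- Opening two bonds. -/
lemma Ex_two {E : Finset α} {e f : α} (he : e ∈ E) (hf : f ∈ E) (hef : e ≠ f) {p : ℝ}
    (h0 : 0 ≤ p) (h1 : p ≤ 1) {F H : Finset α → ℝ} (hF : ∀ S, 0 ≤ F S) (hH : ∀ S, 0 ≤ H S)
    (hH0 : ∀ S, (e ∈ S ∨ f ∈ S) → H S = 0)
    (hFH : ∀ S, e ∉ S → f ∉ S → H S ≤ F (insert e (insert f S))) :
    p ^ 2 * Ex E p H ≤ Ex E p F := by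
  obtain ⟨E0, hf0, he0, rfl⟩ : ∃ E0, f ∉ E0 ∧ e ∉ insert f E0 ∧ E = insert e (insert f E0) := by
    refine ⟨(E.erase e).erase f, by simp, by simp [hef], ?_⟩
    rw [Finset.insert_erase (by simp [hf, hef.symm]), Finset.insert_erase he]
  have he0' : e ∉ E0 := fun h => he0 (Finset.mem_insert_of_mem h)
  simp only [Ex_insert he0, Ex_insert hf0]
  have z1 : Ex E0 p (fun S => H (insert f S)) = 0 := by
    rw [Ex_congr (g := fun _ => 0) (fun S _ => hH0 _ (by simp)), Ex_const]
  have z2 : Ex E0 p (fun S => H (insert e S)) = 0 := by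
    rw [Ex_congr (g := fun _ => 0) (fun S _ => hH0 _ (by simp)), Ex_const]
  have z3 : Ex E0 p (fun S => H (insert e (insert f S))) = 0 := by
    rw [Ex_congr (g := fun _ => 0) (fun S _ => hH0 _ (by simp)), Ex_const]
  have z4 : Ex E0 p H ≤ Ex E0 p (fun S => F (insert e (insert f S))) :=
    Ex_mono h0 h1 fun S hS => hFH S (fun h => he0' (hS h)) (fun h => hf0 (hS h))
  have n0 : 0 ≤ Ex E0 p H := Ex_nonneg h0 h1 fun S _ => hH S
  have n1 : 0 ≤ Ex E0 p F := Ex_nonneg h0 h1 fun S _ => hF S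
  have n2 : 0 ≤ Ex E0 p (fun S => F (insert f S)) := Ex_nonneg h0 h1 fun S _ => hF _
  have n3 : 0 ≤ Ex E0 p (fun S => F (insert e S)) := Ex_nonneg h0 h1 fun S _ => hF _
  rw [z1, z2, z3]
  have hq : 0 ≤ 1 - p := by linarith
  have t1 : p ^ 2 * ((1 - p) * ((1 - p) * Ex E0 p H)) ≤ p ^ 2 * Ex E0 p H := by
    apply mul_le_mul_of_nonneg_left _ (sq_nonneg p)
    nlinarith [mul_nonneg h0 n0, mul_nonneg hq (mul_nonneg h0 n0)]
  have t2 : p ^ 2 * Ex E0 p H ≤ p ^ 2 * Ex E0 p (fun S => F (insert e (insert f S))) :=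
    mul_le_mul_of_nonneg_left z4 (sq_nonneg p)
  have t3 : 0 ≤ (1 - p) * ((1 - p) * Ex E0 p F + p * Ex E0 p (fun S => F (insert f S))) := by
    positivity
  have t4 : 0 ≤ p * ((1 - p) * Ex E0 p (fun S => F (insert e S))) := by positivity
  nlinarith

end basic

end PercAux

namespace PercAux

set_option linter.unusedSectionVars false

section graph
variable {V : Type*} [Fintype V]

/-- The graph of a set of occupied bonds. -/
def gr (S : Finset (Sym2 V)) : SimpleGraph V := SimpleGraph.fromEdgeSet (S : Set (Sym2 V))

/-- The cluster. -/
def cl (S : Finset (Sym2 V)) (x : V) : Finset V :=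
  Finset.univ.filter fun y => (gr S).Reachable x y

def touch (A : Finset V) (e : Sym2 V) : Prop := ∃ v ∈ A, v ∈ e

/-- Bonds which do not touch `A`. -/
def off (A : Finset V) (S : Finset (Sym2 V)) : Finset (Sym2 V) := S.filter fun e => ¬ touch A e

def on (A : Finset V) (S : Finset (Sym2 V)) : Finset (Sym2 V) := S.filter fun e => touch A e

lemma mem_cl {S : Finset (Sym2 V)} {x y : V} : y ∈ cl S x ↔ (gr S).Reachable x y := by
  simp [cl]

lemma gr_adj {S : Finset (Sym2 V)} {x y : V} : (gr S).Adj x y ↔ s(x, y) ∈ S ∧ x ≠ y := by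
  simp [gr]

lemma gr_mono {S T : Finset (Sym2 V)} (h : S ⊆ T) : gr S ≤ gr T := by
  intro x y
  rw [gr_adj, gr_adj]
  exact fun h' => ⟨h h'.1, h'.2⟩

lemma cl_self (S : Finset (Sym2 V)) (x : V) : x ∈ cl S x := mem_cl.2 (SimpleGraph.Reachable.refl x)

lemma cl_step {S : Finset (Sym2 V)} {x a b : V} (ha : a ∈ cl S x) (h : s(a, b) ∈ S) :
    b ∈ cl S x := by
  by_cases hab : a = b
  · rwa [← hab]
  · exact mem_cl.2 ((mem_cl.1 ha).trans (gr_adj.2 ⟨h, hab⟩ : (gr S).Adj a b).reachable)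

lemma cl_subset {S : Finset (Sym2 V)} {x : V} {X : Finset V} (hx : x ∈ X)
    (h : ∀ a b, a ∈ X → s(a, b) ∈ S → b ∈ X) : cl S x ⊆ X := by
  intro y hy
  obtain ⟨w⟩ := mem_cl.1 hy
  clear hy
  induction w with
  | nil => exact hx
  | cons hadj _ ih => exact ih (h _ _ hx (gr_adj.1 hadj).1)

lemma cl_mono {S T : Finset (Sym2 V)} (h : S ⊆ T) (x : V) : cl S x ⊆ cl T x :=
  fun _ hy => mem_cl.2 ((mem_cl.1 hy).mono (gr_mono h))

lemma cl_comm {S : Finset (Sym2 V)} {x y : V} : y ∈ cl S x ↔ x ∈ cl S y := by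
  rw [mem_cl, mem_cl, SimpleGraph.reachable_comm]

lemma cl_eq {S : Finset (Sym2 V)} {x y : V} (h : y ∈ cl S x) : cl S y = cl S x := by
  ext z
  rw [mem_cl, mem_cl]
  exact ⟨fun h' => (mem_cl.1 h).trans h', fun h' => (mem_cl.1 h).symm.trans h'⟩

lemma cl_trans {S : Finset (Sym2 V)} {x y z : V} (h : y ∈ cl S x) (h' : z ∈ cl S y) :
    z ∈ cl S x := by rwa [cl_eq h] at h'

lemma off_subset (A : Finset V) (S : Finset (Sym2 V)) : off A S ⊆ S := Finset.filter_subset _ _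
lemma on_subset (A : Finset V) (S : Finset (Sym2 V)) : on A S ⊆ S := Finset.filter_subset _ _

lemma mem_off {A : Finset V} {S : Finset (Sym2 V)} {a b : V} :
    s(a, b) ∈ off A S ↔ s(a, b) ∈ S ∧ a ∉ A ∧ b ∉ A := by
  simp only [off, touch, Finset.mem_filter, Sym2.mem_iff, not_exists, not_and]
  constructor
  · rintro ⟨h1, h2⟩
    exact ⟨h1, fun h => h2 a h (Or.inl rfl), fun h => h2 b h (Or.inr rfl)⟩
  · rintro ⟨h1, h2, h3⟩
    refine ⟨h1, fun v hv h => ?_⟩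
    rcases h with rfl | rfl
    · exact h2 hv
    · exact h3 hv

lemma mem_on {A : Finset V} {S : Finset (Sym2 V)} {a b : V} (ha : a ∈ A) (h : s(a, b) ∈ S) :
    s(a, b) ∈ on A S := by
  simp only [on, Finset.mem_filter]
  exact ⟨h, a, ha, by simp⟩

lemma off_mono (A : Finset V) {S T : Finset (Sym2 V)} (h : S ⊆ T) : off A S ⊆ off A T :=
  Finset.filter_subset_filter _ h

lemma off_off (A B : Finset V) (S : Finset (Sym2 V)) : off A (off B S) = off (A ∪ B) S := by
  ext e
  induction e using Sym2.ind with
  | _ a b =>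
    rw [mem_off, mem_off, mem_off]
    simp only [Finset.mem_union]
    tauto

lemma cl_off_singleton {S : Finset (Sym2 V)} {s y : V} (h : s ∉ cl S y) :
    cl S y ⊆ cl (off {s} S) y := by
  apply cl_subset (cl_self _ _)
  intro a b ha hab
  have ha' := cl_mono (off_subset {s} S) y ha
  have hb' := cl_step ha' hab
  refine cl_step ha (mem_off.2 ⟨hab, ?_, ?_⟩)
  · simp only [Finset.mem_singleton]; rintro rfl; exact h ha'
  · simp only [Finset.mem_singleton]; rintro rfl; exact h hb'

/-- A cluster disjoint from `A` does not notice the bonds touching `A`. -/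
lemma cl_off_eq {S : Finset (Sym2 V)} {A : Finset V} {y : V} (h : ∀ s ∈ A, s ∉ cl S y) :
    cl (off A S) y = cl S y := by
  apply Finset.Subset.antisymm (cl_mono (off_subset A S) y)
  apply cl_subset (cl_self _ _)
  intro a b ha hab
  have ha' := cl_mono (off_subset A S) y ha
  have hb' := cl_step ha' hab
  exact cl_step ha (mem_off.2 ⟨hab, fun h' => h _ h' ha', fun h' => h _ h' hb'⟩)

lemma cl_on {S : Finset (Sym2 V)} {w : V} {A : Finset V} : cl S w = A ↔ cl (on A S) w = A := by
  constructor
  · intro h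
    apply Finset.Subset.antisymm ((cl_mono (on_subset A S) w).trans h.le)
    nth_rewrite 1 [← h]
    apply cl_subset (cl_self _ _)
    intro a b ha hab
    exact cl_step ha (mem_on (by rw [← h]; exact cl_mono (on_subset A S) w ha) hab)
  · intro h
    apply Finset.Subset.antisymm
    · apply cl_subset (by have := cl_self (on A S) w; rwa [h] at this)
      intro a b ha hab
      have ha' := ha
      rw [← h] at ha ⊢
      exact cl_step ha (mem_on ha' hab)
    · nth_rewrite 1 [← h]; exact cl_mono (on_subset A S) w

/-- Off-cluster vertices: cluster in the off-graph is contained in the complement. -/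
lemma cl_off_disj {S : Finset (Sym2 V)} {A : Finset V} {y s : V} (hy : y ∉ A)
    (hs : s ∈ cl (off A S) y) : s ∉ A := by
  have : cl (off A S) y ⊆ Finset.univ.filter (fun v => v ∉ A) := by
    apply cl_subset (by simpa using hy)
    intro a b _ hab
    simpa using (mem_off.1 hab).2.2
  simpa using this hs

lemma Ex_decouple (E : Finset (Sym2 V)) (p : ℝ) (w : V)
    (Ψ : Finset V → Finset (Sym2 V) → ℝ) :
    Ex E p (fun S => Ψ (cl S w) (off (cl S w) S)) =
      Ex E p (fun S => Ex E p (fun S2 => Ψ (cl S w) (off (cl S w) S2))) := by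
  have key : ∀ (S : Finset (Sym2 V)) (g : Finset V → ℝ),
      g (cl S w) = ∑ A : Finset V, ind (cl (on A S) w = A) * g A := by
    intro S g
    have : ∀ A : Finset V, ind (cl (on A S) w = A) * g A = if cl S w = A then g A else 0 := by
      intro A
      rw [ind, ← cl_on]; split_ifs <;> simp
    simp [this]
  have h1 : ∀ S, Ψ (cl S w) (off (cl S w) S) =
      ∑ A : Finset V, ind (cl (on A S) w = A) * Ψ A (off A S) :=
    fun S => key S (fun A => Ψ A (off A S))
  have h2 : ∀ S, Ex E p (fun S2 => Ψ (cl S w) (off (cl S w) S2)) =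
      ∑ A : Finset V, ind (cl (on A S) w = A) * Ex E p (fun S2 => Ψ A (off A S2)) :=
    fun S => key S (fun A => Ex E p (fun S2 => Ψ A (off A S2)))
  simp only [h1, h2, Ex_sum, Ex_mul_const]
  refine Finset.sum_congr rfl fun A _ => ?_
  exact Ex_indep (touch A) E p (fun S => ind (cl S w = A)) (fun S => Ψ A S)

def s2 (σ : V ≃ V) : Sym2 V ≃ Sym2 V where
  toFun := Sym2.map σ
  invFun := Sym2.map σ.symm
  left_inv := fun e => by
    induction e using Sym2.ind with
    | _ a b => simp
  right_inv := fun e => by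
    induction e using Sym2.ind with
    | _ a b => simp

lemma s2_symm_mk (σ : V ≃ V) (a b : V) : (s2 σ).symm s(a, b) = s(σ.symm a, σ.symm b) := rfl

lemma Ex_transport (E : Finset (Sym2 V)) (p : ℝ) (σ : V ≃ V)
    (hE : ∀ a b, s(a, b) ∈ E ↔ s(σ a, σ b) ∈ E) (f : Finset (Sym2 V) → ℝ) :
    Ex E p f = Ex E p (fun S => f (S.map (s2 σ).toEmbedding)) := by
  rw [← Ex_map]
  congr 1
  ext e
  induction e using Sym2.ind with
  | _ a b =>
    rw [Finset.mem_map_equiv, s2_symm_mk]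
    have := hE (σ.symm a) (σ.symm b)
    simp at this
    simpa using this.symm

lemma cl_map (S : Finset (Sym2 V)) (σ : V ≃ V) (x : V) :
    cl (S.map (s2 σ).toEmbedding) (σ x) = (cl S x).map σ.toEmbedding := by
  apply Finset.Subset.antisymm
  · apply cl_subset (by simp [cl_self])
    intro a b ha hab
    rw [Finset.mem_map_equiv] at ha hab ⊢
    exact cl_step ha (by rwa [s2_symm_mk] at hab)
  · intro y hy
    rw [Finset.mem_map_equiv] at hy
    have : cl S x ⊆ Finset.univ.filter
        (fun v => σ v ∈ cl (S.map (s2 σ).toEmbedding) (σ x)) := by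
      apply cl_subset (by simp [cl_self])
      intro a b ha hab
      simp only [Finset.mem_filter, Finset.mem_univ, true_and] at ha ⊢
      refine cl_step ha ?_
      rw [Finset.mem_map_equiv, s2_symm_mk]
      simpa using hab
    simpa using this hy

end graph
end PercAux

namespace PercAux
set_option linter.unusedSectionVars false

section ghost
variable {V : Type*} [Fintype V]

lemma ind_not (P : Prop) : ind (¬ P) = 1 - ind P := by
  by_cases h : P
  · rw [ind_true h, ind_false (not_not.2 h)]; ring
  · rw [ind_false h, ind_true h]; ring

lemma ind_and (P Q : Prop) : ind (P ∧ Q) = ind P * ind Q := by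
  by_cases h : P <;> by_cases h' : Q <;> simp [ind, h, h']

lemma ind_or_le (P Q : Prop) : ind (P ∨ Q) ≤ ind P + ind Q := by
  by_cases h : P <;> by_cases h' : Q <;> simp [ind, h, h']

lemma ind_exists_le {ι : Type*} (s : Finset ι) (P : ι → Prop) :
    ind (∃ i ∈ s, P i) ≤ ∑ i ∈ s, ind (P i) := by
  by_cases h : ∃ i ∈ s, P i
  · rw [ind_true h]
    obtain ⟨i, hi, hP⟩ := h
    rw [← ind_true hP]
    exact Finset.single_le_sum (f := fun i => ind (P i)) (fun j _ => ind_nonneg (P j)) hi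
  · rw [ind_false h]
    exact Finset.sum_nonneg fun j _ => ind_nonneg _

/-- `1 - (1-γ)^n`. -/
def phi (γ : ℝ) (n : ℕ) : ℝ := 1 - (1 - γ) ^ n

lemma Ex_restr (γ : ℝ) (A : Finset V) (g : Finset V → ℝ) :
    Ex Finset.univ γ (fun T => g (T.filter (fun v => v ∈ A))) = Ex A γ g := by
  convert Ex_filter (fun v => v ∈ A) Finset.univ γ g
  ext; simp

lemma ghost0 (γ : ℝ) (A : Finset V) :
    Ex Finset.univ γ (fun T => ind (Disjoint A T)) = (1 - γ) ^ A.card := by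
  have h : ∀ T : Finset V, ind (Disjoint A T) = ind (T.filter (fun v => v ∈ A) = ∅) := by
    intro T
    congr 1
    rw [Finset.filter_eq_empty_iff, Finset.disjoint_right]
  simp only [h]
  rw [Ex_restr γ A (fun S => ind (S = ∅))]
  unfold Ex
  rw [Finset.sum_eq_single ∅]
  · simp [ind]
  · intro S _ hS
    simp [ind, hS]
  · intro h; exact absurd (Finset.empty_mem_powerset _) h

lemma ghost1 (γ : ℝ) (A : Finset V) :
    Ex Finset.univ γ (fun T => ind (¬ Disjoint A T)) = phi γ A.card := by
  simp only [ind_not, Ex_sub, Ex_const, ghost0, phi]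

lemma ghost3 (γ : ℝ) {A B C : Finset V} (hAB : Disjoint A B) (hAC : Disjoint A C)
    (hBC : Disjoint B C) :
    Ex Finset.univ γ (fun T => ind (Disjoint A T) * ind (¬ Disjoint B T) * ind (¬ Disjoint C T)) =
      (1 - γ) ^ A.card * phi γ B.card * phi γ C.card := by
  have h : ∀ T : Finset V, ind (Disjoint A T) * ind (¬ Disjoint B T) * ind (¬ Disjoint C T) =
      ind (Disjoint A T) - ind (Disjoint (A ∪ B) T) - ind (Disjoint (A ∪ C) T)
        + ind (Disjoint (A ∪ B ∪ C) T) := by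
    intro T
    simp only [Finset.disjoint_union_left, ind_and, ind_not]
    ring
  simp only [h, Ex_add, Ex_sub, ghost0]
  rw [Finset.card_union_of_disjoint hAB, Finset.card_union_of_disjoint hAC,
    Finset.card_union_of_disjoint (Finset.disjoint_union_left.2 ⟨hAC, hBC⟩),
    Finset.card_union_of_disjoint hAB, phi, phi]
  ring

lemma ghost2 (γ : ℝ) (C : Finset V) :
    Ex Finset.univ γ (fun T => ind (2 ≤ (T ∩ C).card)) =
      phi γ C.card - C.card * γ * (1 - γ) ^ (C.card - 1) := by
  have h : ∀ T : Finset V, ind (2 ≤ (T ∩ C).card) =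
      ind (¬ Disjoint C T) - ind ((T.filter (fun v => v ∈ C)).card = 1) := by
    intro T
    have e1 : T.filter (fun v => v ∈ C) = T ∩ C := by ext; simp
    have e2 : Disjoint C T ↔ (T ∩ C).card = 0 := by
      rw [Finset.card_eq_zero, disjoint_comm, Finset.disjoint_iff_inter_eq_empty]
    rw [e1, e2]
    generalize (T ∩ C).card = k
    rcases k with _ | _ | k <;> simp [ind]
  simp only [h, Ex_sub, ghost1]
  congr 1
  rw [Ex_restr γ C (fun S => ind (S.card = 1))]
  unfold Ex
  have : ∀ S ∈ C.powerset, γ ^ S.card * (1 - γ) ^ (C.card - S.card) * ind (S.card = 1) =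
      if S.card = 1 then γ * (1 - γ) ^ (C.card - 1) else 0 := by
    intro S _
    split_ifs with h
    · rw [ind_true h, h]; ring
    · rw [ind_false h]; ring
  rw [Finset.sum_congr rfl this, ← Finset.sum_filter, Finset.sum_const,
    ← Finset.powersetCard_eq_filter, Finset.card_powersetCard, Nat.choose_one_right, nsmul_eq_mul]
  ring

def tau (E : Finset (Sym2 V)) (p : ℝ) (x y : V) : ℝ := Ex E p (fun S => ind (y ∈ cl S x))

lemma walk_cl {S : Finset (Sym2 V)} {a b : V} (w : (gr S).Walk a b) :
    b ∈ cl w.edges.toFinset a := by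
  induction w with
  | nil => exact cl_self _ _
  | @cons u v w h q ih =>
    have h1 : v ∈ cl (SimpleGraph.Walk.cons h q).edges.toFinset u :=
      cl_step (cl_self _ _) (by simp)
    exact cl_trans h1 (cl_mono (by intro e he; simp at he ⊢; exact Or.inr he) _ ih)

lemma walk_sub {S : Finset (Sym2 V)} {a b : V} (w : (gr S).Walk a b) :
    w.edges.toFinset ⊆ S := by
  intro e he
  rw [List.mem_toFinset] at he
  have := SimpleGraph.Walk.edges_subset_edgeSet w he
  simp [gr] at this
  exact this.1

lemma walk_off {S : Finset (Sym2 V)} {A : Finset V} {a b : V} (w : (gr S).Walk a b)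
    (h : ∀ v ∈ w.support, v ∉ A) : b ∈ cl (off A S) a := by
  refine cl_mono ?_ _ (walk_cl w)
  intro e he
  have h1 := walk_sub w he
  rw [List.mem_toFinset] at he
  rw [off, Finset.mem_filter]
  refine ⟨h1, ?_⟩
  rintro ⟨v, hv, hve⟩
  exact h v (SimpleGraph.Walk.mem_support_of_mem_edges he hve) hv

lemma split_path {S : Finset (Sym2 V)} {a b t : V} (P : (gr S).Walk a b) (hP : P.IsPath)
    (ht : t ∈ P.support) : Disjoint (P.takeUntil t ht).edges.toFinset
      (P.dropUntil t ht).edges.toFinset ∧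
      (P.takeUntil t ht).edges.toFinset ⊆ P.edges.toFinset ∧
      (P.dropUntil t ht).edges.toFinset ⊆ P.edges.toFinset := by
  have hn : P.edges.Nodup := hP.isTrail.edges_nodup
  have he : P.edges = (P.takeUntil t ht).edges ++ (P.dropUntil t ht).edges := by
    rw [← SimpleGraph.Walk.edges_append, SimpleGraph.Walk.take_spec]
  rw [he, List.nodup_append'] at hn
  refine ⟨?_, ?_, ?_⟩
  · rw [Finset.disjoint_left]
    intro e h1 h2
    rw [List.mem_toFinset] at h1 h2
    exact hn.2.2 h1 h2
  · rw [he]; intro e h; simp at h ⊢; exact Or.inl h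
  · rw [he]; intro e h; simp at h ⊢; exact Or.inr h

lemma det_B1 {S : Finset (Sym2 V)} {A T : Finset V} {z : V} (h : ¬ Disjoint (cl S z) T) :
    ¬ Disjoint (cl (off A S) z) T ∨
      ∃ s ∈ A, Box (fun S => s ∈ cl S z) (fun S => ¬ Disjoint (cl S s) T) S := by
  rw [Finset.not_disjoint_iff] at h
  obtain ⟨t, ht, htT⟩ := h
  obtain ⟨P, hP⟩ := (mem_cl.1 ht).exists_isPath
  by_cases hA : ∀ v ∈ P.support, v ∉ A
  · left
    rw [Finset.not_disjoint_iff]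
    exact ⟨t, walk_off P hA, htT⟩
  · right
    push Not at hA
    obtain ⟨s, hs, hsA⟩ := hA
    obtain ⟨h1, h2, h3⟩ := split_path P hP hs
    refine ⟨s, hsA, _, _, walk_sub _, walk_sub _, h1, walk_cl _, ?_⟩
    exact Finset.not_disjoint_iff.2 ⟨t, walk_cl _, htT⟩

lemma last_exit {S : Finset (Sym2 V)} {a b v g : V} (P : (gr S).Walk a b) (Q : (gr S).Walk v g) :
    (∃ t ∈ P.support, ∃ R : (gr S).Walk t g, ∀ e ∈ R.edges, e ∉ P.edges) ∨
      (∀ e ∈ Q.edges, e ∉ P.edges) := by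
  induction Q with
  | nil => right; simp
  | @cons u v w h q ih =>
    rcases ih with ih | ih
    · left; exact ih
    · by_cases he : s(u, v) ∈ P.edges
      · left
        exact ⟨v, SimpleGraph.Walk.snd_mem_support_of_mem_edges _ he, q, ih⟩
      · right
        intro e h'
        rw [SimpleGraph.Walk.edges_cons, List.mem_cons] at h'
        rcases h' with rfl | h'
        · exact he
        · exact ih e h'

lemma det_B2 {S : Finset (Sym2 V)} {T : Finset V} {w s : V} (hs : s ∈ cl S w)
    (h : ¬ Disjoint (cl S w) T) :
    ∃ t ∈ (Finset.univ : Finset V), Box (fun S => t ∈ cl S w)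
      (Box (fun S => s ∈ cl S t) (fun S => ¬ Disjoint (cl S t) T)) S := by
  rw [Finset.not_disjoint_iff] at h
  obtain ⟨g, hg, hgT⟩ := h
  obtain ⟨P, hP⟩ := (mem_cl.1 hs).exists_isPath
  obtain ⟨Q⟩ := mem_cl.1 hg
  have : ∃ t ∈ P.support, ∃ R : (gr S).Walk t g, ∀ e ∈ R.edges, e ∉ P.edges := by
    rcases last_exit P Q with h | h
    · exact h
    · exact ⟨w, P.start_mem_support, Q, h⟩
  obtain ⟨t, ht, R, hR⟩ := this
  obtain ⟨h1, h2, h3⟩ := split_path P hP ht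
  refine ⟨t, Finset.mem_univ _, (P.takeUntil t ht).edges.toFinset,
    (P.dropUntil t ht).edges.toFinset ∪ R.edges.toFinset, walk_sub _,
    Finset.union_subset (walk_sub _) (walk_sub _), ?_, walk_cl _, ?_⟩
  · rw [Finset.disjoint_union_right]
    refine ⟨h1, ?_⟩
    rw [Finset.disjoint_left]
    intro e he1 he2
    exact hR e (List.mem_toFinset.1 he2) (List.mem_toFinset.1 (h2 he1))
  · refine ⟨(P.dropUntil t ht).edges.toFinset, R.edges.toFinset, Finset.subset_union_left,
      Finset.subset_union_right, ?_, walk_cl _, ?_⟩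
    · rw [Finset.disjoint_left]
      intro e he1 he2
      exact hR e (List.mem_toFinset.1 he2) (List.mem_toFinset.1 (h3 he1))
    · exact Finset.not_disjoint_iff.2 ⟨g, walk_cl R, hgT⟩

lemma inc_conn (x y : V) : Inc (fun S : Finset (Sym2 V) => y ∈ cl S x) :=
  fun _ _ h h' => cl_mono h x h'

lemma inc_T (x : V) (T : Finset V) : Inc (fun S : Finset (Sym2 V) => ¬ Disjoint (cl S x) T) :=
  fun _ _ h h' h'' => h' (Finset.disjoint_of_subset_left (cl_mono h x) h'')

variable {E : Finset (Sym2 V)} {p γ M : ℝ}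

lemma tau_nonneg (h0 : 0 ≤ p) (h1 : p ≤ 1) (x y : V) : 0 ≤ tau E p x y :=
  Ex_nonneg h0 h1 fun _ _ => ind_nonneg _

lemma swapT (x : V) : Ex Finset.univ γ (fun T => Ex E p (fun S => ind (¬ Disjoint (cl S x) T))) =
    Ex E p (fun S => phi γ (cl S x).card) := by
  rw [Ex_comm]
  simp only [ghost1]

lemma bound_B1 (h0 : 0 ≤ p) (h1 : p ≤ 1 / 2) (g0 : 0 ≤ γ) (g1 : γ ≤ 1)
    (hM : ∀ x, Ex E p (fun S => phi γ (cl S x).card) = M) (A : Finset V) (z : V) :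
    M - (∑ s ∈ A, tau E p z s) * M ≤ Ex E p (fun S => phi γ (cl (off A S) z).card) := by
  have key : ∀ T : Finset V, Ex E p (fun S => ind (¬ Disjoint (cl S z) T)) ≤
      Ex E p (fun S => ind (¬ Disjoint (cl (off A S) z) T)) +
      ∑ s ∈ A, tau E p z s * Ex E p (fun S => ind (¬ Disjoint (cl S s) T)) := by
    intro T
    calc Ex E p (fun S => ind (¬ Disjoint (cl S z) T)) ≤
        Ex E p (fun S => ind (¬ Disjoint (cl (off A S) z) T) + ∑ s ∈ A,
          ind (Box (fun S => s ∈ cl S z) (fun S => ¬ Disjoint (cl S s) T) S)) := by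
          refine Ex_mono h0 (by linarith) fun S _ => ?_
          refine (ind_mono (det_B1 (A := A))).trans ((ind_or_le _ _).trans ?_)
          gcongr
          exact ind_exists_le _ _
      _ ≤ _ := by
          rw [Ex_add, Ex_sum]
          gcongr with s hs
          exact BK E h0 h1 _ _ (inc_conn z s) (inc_T s T)
  have := Ex_mono (I := Finset.univ) g0 g1 (fun T _ => key T)
  rw [swapT, hM, Ex_add, Ex_sum, Ex_comm] at this
  simp only [Ex_const_mul, swapT, hM, ghost1] at this
  rw [← Finset.sum_mul] at this
  linarith

lemma bound_B2 (h0 : 0 ≤ p) (h1 : p ≤ 1 / 2) (g0 : 0 ≤ γ) (g1 : γ ≤ 1)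
    (hM : ∀ x, Ex E p (fun S => phi γ (cl S x).card) = M) (w s : V) :
    Ex E p (fun S => ind (s ∈ cl S w) * phi γ (cl S w).card) ≤
      (∑ t, tau E p w t * tau E p t s) * M := by
  have key : ∀ T : Finset V, Ex E p (fun S => ind (s ∈ cl S w) * ind (¬ Disjoint (cl S w) T)) ≤
      ∑ t, tau E p w t * (tau E p t s * Ex E p (fun S => ind (¬ Disjoint (cl S t) T))) := by
    intro T
    calc Ex E p (fun S => ind (s ∈ cl S w) * ind (¬ Disjoint (cl S w) T)) ≤
        Ex E p (fun S => ∑ t, ind (Box (fun S => t ∈ cl S w)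
      (Box (fun S => s ∈ cl S t) (fun S => ¬ Disjoint (cl S t) T)) S)) := by
          refine Ex_mono h0 (by linarith) fun S _ => ?_
          rw [← ind_and]
          exact (ind_mono (fun h => det_B2 h.1 h.2)).trans (ind_exists_le _ _)
      _ ≤ _ := by
          rw [Ex_sum]
          gcongr with t _
          refine (BK E h0 h1 _ _ (inc_conn w t) Box_inc).trans ?_
          exact mul_le_mul_of_nonneg_left (BK E h0 h1 _ _ (inc_conn t s) (inc_T t T))
            (tau_nonneg h0 (by linarith) w t)
  have := Ex_mono (I := Finset.univ) g0 g1 (fun T _ => key T)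
  rw [Ex_comm, Ex_sum] at this
  simp only [Ex_const_mul, swapT, hM, ghost1] at this
  rw [Finset.sum_mul]
  simpa only [mul_assoc] using this

end ghost
end PercAux

namespace PercAux
set_option linter.unusedSectionVars false

section uniq
variable {V : Type*} [Fintype V]

/-- The event in the configuration with the two bonds removed. -/
def Ev (S : Finset (Sym2 V)) (T : Finset V) (x w y z : V) : Prop :=
  x ∈ cl S w ∧ Disjoint (cl S w) T ∧ ¬ Disjoint (cl S y) T ∧ ¬ Disjoint (cl S z) T ∧
    y ∉ cl S w ∧ z ∉ cl S w ∧ z ∉ cl S y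

def Good (η : Finset (Sym2 V)) (T : Finset V) (x w y z : V) : Prop :=
  s(w, y) ∈ η ∧ s(w, z) ∈ η ∧ Ev ((η.erase s(w, y)).erase s(w, z)) T x w y z

variable {η : Finset (Sym2 V)} {T : Finset V} {x w y z : V}

lemma sub_er : (η.erase s(w, y)).erase s(w, z) ⊆ η :=
  (Finset.erase_subset _ _).trans (Finset.erase_subset _ _)

lemma Good.sw (h : Good η T x w y z) : Good η T x w z y := by
  obtain ⟨h1, h2, h3, h4, h5, h6, h7, h8, h9⟩ := h
  rw [Finset.erase_right_comm] at h3 h4 h5 h6 h7 h8 h9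
  exact ⟨h2, h1, h3, h4, h6, h5, h8, h7, fun h => h9 (cl_comm.1 h)⟩

lemma Good.sub (h : Good η T x w y z) {u : V}
    (hu : u ∈ cl ((η.erase s(w, y)).erase s(w, z)) w) :
    cl (off {w} η) u ⊆ cl ((η.erase s(w, y)).erase s(w, z)) w := by
  apply cl_subset hu
  intro a b ha hab
  obtain ⟨h1, h2, h3⟩ := mem_off.1 hab
  refine cl_step ha ?_
  simp only [Finset.mem_singleton] at h2 h3
  simp only [Finset.mem_erase, ne_eq, Sym2.eq_iff]
  refine ⟨?_, ?_, h1⟩ <;> tauto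

lemma Good.F1 (h : Good η T x w y z) : Disjoint (cl (off {w} η) x) T :=
  Finset.disjoint_of_subset_left (h.sub h.2.2.1) h.2.2.2.1

lemma F2aux (h1 : s(w, y) ∈ η)
    (h2 : ¬ Disjoint (cl ((η.erase s(w, y)).erase s(w, z)) y) T) {s : V} (hs : s ≠ w)
    (h3 : s ∉ cl ((η.erase s(w, y)).erase s(w, z)) y) : ¬ Disjoint (cl (off {s} η) w) T := by
  intro hd
  apply h2
  refine Finset.disjoint_of_subset_left ?_ hd
  refine (cl_off_singleton h3).trans ((cl_mono (off_mono {s} sub_er) y).trans ?_)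
  have : y ∈ cl (off {s} η) w := by
    refine cl_step (cl_self _ _) (mem_off.2 ⟨h1, by simpa using hs.symm, ?_⟩)
    simp only [Finset.mem_singleton]
    rintro rfl
    exact h3 (cl_self _ _)
  rw [cl_eq this]

lemma Good.F2 (h : Good η T x w y z) {s : V} (hs : s ≠ w) :
    ¬ Disjoint (cl (off {s} η) w) T := by
  by_cases h3 : s ∈ cl ((η.erase s(w, y)).erase s(w, z)) y
  · have h' := h.sw
    have h3' : s ∉ cl ((η.erase s(w, z)).erase s(w, y)) z := by
      rw [Finset.erase_right_comm]
      intro h4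
      exact h.2.2.2.2.2.2.2.2 (cl_trans h3 (cl_comm.1 h4))
    exact F2aux h'.1 h'.2.2.2.2.1 hs h3'
  · exact F2aux h.1 h.2.2.2.2.1 hs h3

lemma Good.conn (h : Good η T x w y z) : w ∈ cl η x :=
  cl_mono sub_er x (cl_comm.1 h.2.2.1)

lemma two_sided {w' : V} (h1 : w ∈ cl η x) (hne : w ≠ w') :
    w ∈ cl (off {w'} η) x ∨ w' ∈ cl (off {w} η) x := by
  obtain ⟨P, hP⟩ := (mem_cl.1 h1).exists_isPath
  by_cases hw : w' ∈ P.support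
  · right
    apply walk_off (P.takeUntil w' hw)
    intro v hv
    simp only [Finset.mem_singleton]
    rintro rfl
    exact SimpleGraph.Walk.endpoint_notMem_support_takeUntil hP hw hne hv
  · left
    apply walk_off P
    intro v hv
    simp only [Finset.mem_singleton]
    rintro rfl
    exact hw hv

lemma Good.excl {w' y' z' : V} (h : Good η T x w y z) (h' : Good η T x w' y' z') (hne : w' ≠ w)
    (hc : w ∈ cl (off {w'} η) x) : False := by
  apply h.F2 hne
  rw [cl_eq hc]
  exact h'.F1

lemma Good.uniq_w {w' y' z' : V} (h : Good η T x w y z) (h' : Good η T x w' y' z') : w' = w := by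
  by_contra hne
  rcases two_sided h.conn (Ne.symm hne) with hc | hc
  · exact h.excl h' hne hc
  · exact h'.excl h (Ne.symm hne) hc

lemma Good.F3 (h : Good η T x w y z) {u : V} (hu : s(w, u) ∈ η)
    (hd : ¬ Disjoint (cl (off {w} η) u) T) : u = y ∨ u = z := by
  by_contra hcon
  push Not at hcon
  apply hd
  refine Finset.disjoint_of_subset_left (h.sub ?_) h.2.2.2.1
  refine cl_step (cl_self _ _) ?_
  simp only [Finset.mem_erase, ne_eq, Sym2.eq_iff]
  refine ⟨?_, ?_, hu⟩
  · rintro (⟨_, h1⟩ | ⟨h1, h2⟩)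
    · exact hcon.2 h1
    · exact hcon.2 (h2.trans h1)
  · rintro (⟨_, h1⟩ | ⟨h1, h2⟩)
    · exact hcon.1 h1
    · exact hcon.1 (h2.trans h1)

lemma Good.F4 (h : Good η T x w y z) : ¬ Disjoint (cl (off {w} η) y) T := by
  obtain ⟨h1, h2, h3, h4, h5, h6, h7, h8, h9⟩ := h
  intro hd
  apply h5
  refine Finset.disjoint_of_subset_left ?_ hd
  refine (cl_off_singleton (s := w) (fun h => h7 (cl_comm.1 h))).trans
    (cl_mono (off_mono {w} sub_er) y)

lemma Good.ne (h : Good η T x w y z) : y ≠ z := by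
  rintro rfl
  exact h.2.2.2.2.2.2.2.2 (cl_self _ _)

lemma Good.uniq {w' y' z' : V} (h : Good η T x w y z) (h' : Good η T x w' y' z') :
    (w', y', z') = (w, y, z) ∨ (w', y', z') = (w, z, y) := by
  obtain rfl := h.uniq_w h'
  have a := h.F3 h'.1 h'.F4
  have b := h.F3 h'.sw.1 h'.sw.F4
  have c := h'.ne
  rcases a with rfl | rfl <;> rcases b with rfl | rfl <;> simp_all

lemma Good.two (h : Good η T x w y z) : 2 ≤ (T ∩ cl η x).card := by
  obtain ⟨h1, h2, h3, h4, h5, h6, h7, h8, h9⟩ := h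
  obtain ⟨a, ha, haT⟩ := Finset.not_disjoint_iff.1 h5
  obtain ⟨b, hb, hbT⟩ := Finset.not_disjoint_iff.1 h6
  have hw : w ∈ cl η x := cl_mono sub_er x (cl_comm.1 h3)
  have ha' : a ∈ cl η x := cl_trans (cl_step hw h1) (cl_mono sub_er _ ha)
  have hb' : b ∈ cl η x := cl_trans (cl_step hw h2) (cl_mono sub_er _ hb)
  have hab : a ≠ b := by
    rintro rfl
    exact h9 (cl_trans ha (cl_comm.1 hb))
  rw [← Finset.card_pair hab]
  apply Finset.card_le_card
  intro v hv
  simp only [Finset.mem_insert, Finset.mem_singleton] at hv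
  rw [Finset.mem_inter]
  rcases hv with rfl | rfl
  · exact ⟨haT, ha'⟩
  · exact ⟨hbT, hb'⟩

lemma sum_good (η : Finset (Sym2 V)) (T : Finset V) (x : V) :
    ∑ w, ∑ y, ∑ z, ind (Good η T x w y z) ≤ 2 * ind (2 ≤ (T ∩ cl η x).card) := by
  have e : ∑ w, ∑ y, ∑ z, ind (Good η T x w y z) =
      ∑ t : V × V × V, ind (Good η T x t.1 t.2.1 t.2.2) := by
    simp only [Fintype.sum_prod_type]
  rw [e]
  by_cases h : ∃ t : V × V × V, Good η T x t.1 t.2.1 t.2.2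
  · obtain ⟨t, ht⟩ := h
    rw [ind_true ht.two]
    calc ∑ t : V × V × V, ind (Good η T x t.1 t.2.1 t.2.2)
        ≤ ∑ t' : V × V × V, ((if t' = t then (1 : ℝ) else 0) +
          (if t' = (t.1, t.2.2, t.2.1) then (1 : ℝ) else 0)) := by
          refine Finset.sum_le_sum fun t' _ => ?_
          by_cases h' : Good η T x t'.1 t'.2.1 t'.2.2
          · rw [ind_true h']
            rcases ht.uniq h' with h1 | h1
            · have : t' = t := h1
              rw [if_pos this]; split_ifs <;> norm_num
            · have : t' = (t.1, t.2.2, t.2.1) := h1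
              rw [if_pos this]; split_ifs <;> norm_num
          · rw [ind_false h']; split_ifs <;> norm_num
      _ = 2 * 1 := by
          rw [Finset.sum_add_distrib]
          simp only [Finset.sum_ite_eq', Finset.mem_univ, if_true]
          norm_num
  · push Not at h
    rw [Finset.sum_eq_zero (fun t _ => ind_false (h t))]
    exact mul_nonneg (by norm_num) (ind_nonneg _)

variable {E : Finset (Sym2 V)} {p γ M : ℝ}

/-- `n (1-γ)^n`. -/
def fn (γ : ℝ) (n : ℕ) : ℝ := n * (1 - γ) ^ n

/-- the three-cluster term -/
def RR (E : Finset (Sym2 V)) (p γ : ℝ) (w y z : V) : ℝ :=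
  Ex E p (fun S => fn γ (cl S w).card * phi γ (cl S y).card * phi γ (cl S z).card *
    ind (y ∉ cl S w ∧ z ∉ cl S w ∧ z ∉ cl S y))

lemma ev_two (h0 : 0 ≤ p) (h1 : p ≤ 1) (he : s(w, y) ∈ E) (hf : s(w, z) ∈ E) (hyz : y ≠ z)
    (T : Finset V) (x : V) :
    p ^ 2 * Ex E p (fun S => ind (Ev S T x w y z)) ≤ Ex E p (fun S => ind (Good S T x w y z)) := by
  have hef : s(w, y) ≠ s(w, z) := by
    simp only [ne_eq, Sym2.eq_iff]
    rintro (⟨_, h⟩ | ⟨h1, h2⟩)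
    · exact hyz h
    · exact hyz (h2.trans h1)
  apply Ex_two he hf hef h0 h1 (fun _ => ind_nonneg _) (fun _ => ind_nonneg _)
  · rintro S (hS | hS)
    · exact ind_false fun h => h.2.2.2.2.1 (cl_step (cl_self _ _) hS)
    · exact ind_false fun h => h.2.2.2.2.2.1 (cl_step (cl_self _ _) hS)
  · intro S hS1 hS2
    apply ind_mono
    intro h
    refine ⟨by simp, by simp, ?_⟩
    convert h using 1
    ext e
    simp only [Finset.mem_erase, Finset.mem_insert]
    constructor
    · rintro ⟨h1, h2, h3⟩
      rcases h3 with h3 | h3 | h3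
      · exact absurd h3 h2
      · exact absurd h3 h1
      · exact h3
    · intro h3
      exact ⟨fun h => hS2 (h ▸ h3), fun h => hS1 (h ▸ h3), Or.inr (Or.inr h3)⟩

lemma sum_ind_mem (A : Finset V) : ∑ x, ind (x ∈ A) = (A.card : ℝ) := by
  rw [← Finset.sum_subset (Finset.subset_univ A) (fun x _ h => ind_false h),
    Finset.sum_congr rfl (fun x h => ind_true h)]
  simp

lemma cl_disjoint {S : Finset (Sym2 V)} {a b : V} (h : b ∉ cl S a) : Disjoint (cl S a) (cl S b) := by
  rw [Finset.disjoint_left]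
  intro v h1 h2
  exact h (cl_trans h1 (cl_comm.1 h2))

lemma sum_ev (S : Finset (Sym2 V)) :
    ∑ x, Ex Finset.univ γ (fun T => ind (Ev S T x w y z)) =
      fn γ (cl S w).card * phi γ (cl S y).card * phi γ (cl S z).card *
    ind (y ∉ cl S w ∧ z ∉ cl S w ∧ z ∉ cl S y) := by
  have h : ∀ x T, ind (Ev S T x w y z) = ind (x ∈ cl S w) *
      ((ind (Disjoint (cl S w) T) * ind (¬ Disjoint (cl S y) T) * ind (¬ Disjoint (cl S z) T)) *
      ind (y ∉ cl S w ∧ z ∉ cl S w ∧ z ∉ cl S y)) := by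
    intro x T
    simp only [Ev, ind_and]
    ring
  simp only [h, Ex_const_mul, Ex_mul_const]
  rw [← Finset.sum_mul]
  have hc : ∑ x, ind (x ∈ cl S w) = (cl S w).card := sum_ind_mem _
  rw [hc]
  by_cases hd : y ∉ cl S w ∧ z ∉ cl S w ∧ z ∉ cl S y
  · rw [ghost3 γ (cl_disjoint hd.1) (cl_disjoint hd.2.1) (cl_disjoint hd.2.2), fn]
    ring
  · rw [ind_false hd]; ring

lemma main_upper (h0 : 0 ≤ p) (h1 : p ≤ 1) (g0 : 0 ≤ γ) (g1 : γ ≤ 1) :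
    p ^ 2 * ∑ w, ∑ y, ∑ z, ind (s(w, y) ∈ E ∧ s(w, z) ∈ E ∧ y ≠ z) * RR E p γ w y z ≤
      ∑ x, 2 * Ex E p (fun S => phi γ (cl S x).card -
        (cl S x).card * γ * (1 - γ) ^ ((cl S x).card - 1)) := by
  have a1 : ∀ w y z : V, p ^ 2 * (ind (s(w, y) ∈ E ∧ s(w, z) ∈ E ∧ y ≠ z) * RR E p γ w y z) ≤
      ∑ x, Ex Finset.univ γ (fun T => Ex E p (fun S => ind (Good S T x w y z))) := by
    intro w y z
    by_cases h : s(w, y) ∈ E ∧ s(w, z) ∈ E ∧ y ≠ z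
    · rw [ind_true h, one_mul, RR]
      simp only [← sum_ev]
      rw [Ex_sum, Finset.mul_sum]
      refine Finset.sum_le_sum fun x _ => ?_
      rw [Ex_comm, ← Ex_const_mul]
      exact Ex_mono g0 g1 fun T _ => ev_two h0 h1 h.1 h.2.1 h.2.2 T x
    · rw [ind_false h, zero_mul, mul_zero]
      exact Finset.sum_nonneg fun x _ => Ex_nonneg g0 g1 fun T _ => Ex_nonneg h0 h1
        fun S _ => ind_nonneg _
  have a2 : ∀ x : V, ∑ w, ∑ y, ∑ z,
      Ex Finset.univ γ (fun T => Ex E p (fun S => ind (Good S T x w y z))) ≤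
      2 * Ex E p (fun S => phi γ (cl S x).card -
        (cl S x).card * γ * (1 - γ) ^ ((cl S x).card - 1)) := by
    intro x
    simp only [← ghost2, ← Ex_const_mul, ← Ex_sum]
    rw [Ex_comm]
    refine Ex_mono h0 h1 fun S _ => Ex_mono g0 g1 fun T _ => sum_good S T x
  simp only [Finset.mul_sum]
  refine le_trans (Finset.sum_le_sum fun w _ => Finset.sum_le_sum fun y _ =>
    Finset.sum_le_sum fun z _ => a1 w y z) ?_
  refine le_trans (le_of_eq ?_) (Finset.sum_le_sum fun x _ => a2 x)
  exact (Finset.sum_congr rfl fun w _ => (Finset.sum_congr rfl fun y _ =>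
    Finset.sum_comm).trans Finset.sum_comm).trans Finset.sum_comm

end uniq
end PercAux

namespace PercAux
set_option linter.unusedSectionVars false

section lower
variable {V : Type*} [Fintype V]
variable {E : Finset (Sym2 V)} {p γ M : ℝ}

lemma phi_mono (g0 : 0 ≤ γ) (g1 : γ ≤ 1) {m n : ℕ} (h : m ≤ n) : phi γ m ≤ phi γ n := by
  unfold phi
  have := pow_le_pow_of_le_one (a := 1 - γ) (by linarith) (by linarith) h
  linarith

lemma phi_nonneg (g0 : 0 ≤ γ) (g1 : γ ≤ 1) (n : ℕ) : 0 ≤ phi γ n := by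
  have := phi_mono g0 g1 (Nat.zero_le n)
  simpa [phi] using this

lemma phi_le_one (g1 : γ ≤ 1) (n : ℕ) : phi γ n ≤ 1 := by
  have := pow_nonneg (by linarith : (0 : ℝ) ≤ 1 - γ) n
  unfold phi; linarith

lemma fn_nonneg (g1 : γ ≤ 1) (n : ℕ) : 0 ≤ fn γ n :=
  mul_nonneg (Nat.cast_nonneg n) (pow_nonneg (by linarith) n)

lemma fn_le_phi (g0 : 0 ≤ γ) (g1 : γ ≤ 1) (n : ℕ) : γ * fn γ n ≤ phi γ n := by
  induction n with
  | zero => simp [fn, phi]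
  | succ n ih =>
    unfold fn phi at *
    have h := pow_nonneg (by linarith : (0 : ℝ) ≤ 1 - γ) n
    push_cast
    rw [pow_succ]
    have h2 : 0 ≤ γ * (γ * ((n + 1) * (1 - γ) ^ n)) := by positivity
    nlinarith

def tri (E : Finset (Sym2 V)) (p : ℝ) (x y : V) : ℝ :=
  ∑ u, ∑ v, tau E p x u * tau E p u v * tau E p v y

lemma tau_symm (x y : V) : tau E p x y = tau E p y x := by
  unfold tau
  congr 1
  ext S
  rw [cl_comm]

lemma tau_self (x : V) : tau E p x x = 1 := by
  unfold tau
  rw [Ex_congr (g := fun _ => 1) (fun S _ => ind_true (cl_self S x)), Ex_const]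

lemma one_le_sum_tau (h0 : 0 ≤ p) (h1 : p ≤ 1) {A : Finset V} {z : V} (hz : z ∈ A) :
    1 ≤ ∑ s ∈ A, tau E p z s := by
  rw [← tau_self (E := E) (p := p) z]
  exact Finset.single_le_sum (f := fun s => tau E p z s) (fun s _ => tau_nonneg h0 h1 z s) hz

lemma tri_nonneg (h0 : 0 ≤ p) (h1 : p ≤ 1) (x y : V) : 0 ≤ tri E p x y :=
  Finset.sum_nonneg fun u _ => Finset.sum_nonneg fun v _ =>
    mul_nonneg (mul_nonneg (tau_nonneg h0 h1 _ _) (tau_nonneg h0 h1 _ _)) (tau_nonneg h0 h1 _ _)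

lemma tau_le_tri (h0 : 0 ≤ p) (h1 : p ≤ 1) (x y : V) : tau E p x y ≤ tri E p x y := by
  have n : ∀ u v, 0 ≤ tau E p x u * tau E p u v * tau E p v y := fun u v =>
    mul_nonneg (mul_nonneg (tau_nonneg h0 h1 _ _) (tau_nonneg h0 h1 _ _)) (tau_nonneg h0 h1 _ _)
  calc tau E p x y = tau E p x x * tau E p x x * tau E p x y := by rw [tau_self]; ring
    _ ≤ ∑ v, tau E p x x * tau E p x v * tau E p v y :=
        Finset.single_le_sum (f := fun v => tau E p x x * tau E p x v * tau E p v y)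
          (fun v _ => n x v) (Finset.mem_univ x)
    _ ≤ _ := Finset.single_le_sum (f := fun u => ∑ v, tau E p x u * tau E p u v * tau E p v y)
          (fun u _ => Finset.sum_nonneg fun v _ => n u v) (Finset.mem_univ x)

lemma bound_B2sum (h0 : 0 ≤ p) (h1 : p ≤ 1 / 2) (g0 : 0 ≤ γ) (g1 : γ ≤ 1)
    (hM : ∀ x, Ex E p (fun S => phi γ (cl S x).card) = M) (y z : V) :
    Ex E p (fun S => (∑ s ∈ cl S y, tau E p z s) * phi γ (cl S y).card) ≤ tri E p y z * M := by
  have e : ∀ S : Finset (Sym2 V), (∑ s ∈ cl S y, tau E p z s) * phi γ (cl S y).card =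
      ∑ s, tau E p z s * (ind (s ∈ cl S y) * phi γ (cl S y).card) := by
    intro S
    rw [Finset.sum_mul]
    rw [← Finset.sum_subset (Finset.subset_univ (cl S y))
      (fun s _ h => by rw [ind_false h, zero_mul, mul_zero])]
    exact Finset.sum_congr rfl fun s hs => by rw [ind_true hs, one_mul]
  simp only [e, Ex_sum, Ex_const_mul]
  calc _ ≤ ∑ s, tau E p z s * ((∑ t, tau E p y t * tau E p t s) * M) :=
        Finset.sum_le_sum fun s _ => mul_le_mul_of_nonneg_left (bound_B2 h0 h1 g0 g1 hM y s)
          (tau_nonneg h0 (by linarith) _ _)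
    _ = tri E p y z * M := by
        unfold tri
        rw [Finset.sum_comm]
        simp only [Finset.sum_mul, Finset.mul_sum]
        refine Finset.sum_congr rfl fun s _ => Finset.sum_congr rfl fun t _ => ?_
        rw [tau_symm z s]; ring

lemma Ex_off (A : Finset V) (g : Finset (Sym2 V) → ℝ) :
    Ex E p (fun S => g (off A S)) = Ex (off A E) p g := by
  unfold off
  convert Ex_filter (fun e => ¬ touch A e) E p g

lemma Ex_dec {f : Finset (Sym2 V) → ℝ} {w : V} (Ψ : Finset V → Finset (Sym2 V) → ℝ)
    (h : ∀ S, f S = Ψ (cl S w) (off (cl S w) S)) :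
    Ex E p f = Ex E p (fun S => Ex E p (fun S2 => Ψ (cl S w) (off (cl S w) S2))) := by
  rw [← Ex_decouple]
  exact Ex_congr fun S _ => h S

lemma inner_lower (h0 : 0 ≤ p) (h1 : p ≤ 1 / 2) (g0 : 0 ≤ γ) (g1 : γ ≤ 1)
    (hM : ∀ x, Ex E p (fun S => phi γ (cl S x).card) = M) (A : Finset V) (y z : V) :
    M ^ 2 * (1 - ∑ s ∈ A, tau E p y s - ∑ s ∈ A, tau E p z s - tri E p y z) ≤
      ind (y ∉ A ∧ z ∉ A) * Ex E p (fun S => phi γ (cl (off A S) y).card *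
        phi γ (cl (off A S) z).card * ind (z ∉ cl (off A S) y)) := by
  have h1' : p ≤ 1 := by linarith
  have M0 : 0 ≤ M := by rw [← hM y]; exact Ex_nonneg h0 h1' fun S _ => phi_nonneg g0 g1 _
  have t0 := tri_nonneg (E := E) h0 h1' y z
  have sy : 0 ≤ ∑ s ∈ A, tau E p y s := Finset.sum_nonneg fun s _ => tau_nonneg h0 h1' _ _
  have sz : 0 ≤ ∑ s ∈ A, tau E p z s := Finset.sum_nonneg fun s _ => tau_nonneg h0 h1' _ _
  by_cases hA : y ∉ A ∧ z ∉ A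
  swap
  · rw [ind_false hA, zero_mul]
    have : 1 ≤ ∑ s ∈ A, tau E p y s + ∑ s ∈ A, tau E p z s := by
      by_cases hy : y ∈ A
      · have := one_le_sum_tau (E := E) h0 h1' hy; linarith
      · have hz : z ∈ A := by tauto
        have := one_le_sum_tau (E := E) h0 h1' hz; linarith
    exact mul_nonpos_of_nonneg_of_nonpos (sq_nonneg M) (by linarith)
  rw [ind_true hA, one_mul]
  rw [Ex_off A (fun S => phi γ (cl S y).card * phi γ (cl S z).card * ind (z ∉ cl S y))]
  have e1 : ∀ S : Finset (Sym2 V), phi γ (cl S y).card * phi γ (cl S z).card * ind (z ∉ cl S y) =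
      (fun (B : Finset V) (X : Finset (Sym2 V)) => phi γ B.card * phi γ (cl X z).card * ind (z ∉ B))
        (cl S y) (off (cl S y) S) := by
    intro S
    by_cases hz : z ∈ cl S y
    · simp only []
      rw [ind_false (not_not.2 hz)]; ring
    · simp only []
      rw [cl_off_eq]
      intro s hs hs'
      exact hz (cl_trans hs (cl_comm.1 hs'))
  rw [Ex_dec (fun B X => phi γ B.card * phi γ (cl X z).card * ind (z ∉ B)) e1]
  rw [← Ex_off A (fun S => Ex (off A E) p (fun S2 => phi γ (cl S y).card *
    phi γ (cl (off (cl S y) S2) z).card * ind (z ∉ cl S y)))]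
  have e2 : ∀ S, phi γ (cl (off A S) y).card * (M - (∑ s ∈ cl (off A S) y, tau E p z s +
      ∑ s ∈ A, tau E p z s) * M) ≤ Ex (off A E) p (fun S2 => phi γ (cl (off A S) y).card *
    phi γ (cl (off (cl (off A S) y) S2) z).card * ind (z ∉ cl (off A S) y)) := by
    intro S
    generalize cl (off A S) y = B
    rw [← Ex_off A (fun S2 => phi γ B.card * phi γ (cl (off B S2) z).card * ind (z ∉ B))]
    simp only [off_off]
    rw [Ex_mul_const, Ex_const_mul, mul_assoc]
    refine mul_le_mul_of_nonneg_left ?_ (phi_nonneg g0 g1 _)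
    have sB : 0 ≤ ∑ s ∈ B, tau E p z s := Finset.sum_nonneg fun s _ => tau_nonneg h0 h1' _ _
    by_cases hz : z ∈ B
    · rw [ind_false (not_not.2 hz), mul_zero]
      have := one_le_sum_tau (E := E) h0 h1' hz
      nlinarith
    · rw [ind_true hz, mul_one]
      refine le_trans ?_ (bound_B1 h0 h1 g0 g1 hM (B ∪ A) z)
      have : ∑ s ∈ B ∪ A, tau E p z s ≤ ∑ s ∈ B, tau E p z s + ∑ s ∈ A, tau E p z s := by
        rw [← Finset.sum_union_inter]
        have : 0 ≤ ∑ s ∈ B ∩ A, tau E p z s := Finset.sum_nonneg fun s _ => tau_nonneg h0 h1' _ _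
        linarith
      nlinarith
  refine le_trans ?_ (Ex_mono h0 h1' fun S _ => e2 S)
  set a := ∑ s ∈ A, tau E p z s
  set c := ∑ s ∈ A, tau E p y s
  have e3 : Ex E p (fun S => phi γ (cl (off A S) y).card * (M - (∑ s ∈ cl (off A S) y, tau E p z s +
      a) * M)) = Ex E p (fun S => phi γ (cl (off A S) y).card) * (M - a * M) -
      Ex E p (fun S => (∑ s ∈ cl (off A S) y, tau E p z s) * phi γ (cl (off A S) y).card) * M := by
    rw [← Ex_mul_const, ← Ex_mul_const, ← Ex_sub]
    congr 1
    ext S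
    ring
  rw [e3]
  have b1 := bound_B1 h0 h1 g0 g1 hM A y
  have b2 : Ex E p (fun S => phi γ (cl (off A S) y).card) ≤ M := by
    rw [← hM y]
    exact Ex_mono h0 h1' fun S _ =>
      phi_mono g0 g1 (Finset.card_le_card (cl_mono (off_subset A S) y))
  have b3 : Ex E p (fun S => (∑ s ∈ cl (off A S) y, tau E p z s) * phi γ (cl (off A S) y).card) ≤
      tri E p y z * M := by
    refine le_trans (Ex_mono h0 h1' fun S _ => ?_) (bound_B2sum h0 h1 g0 g1 hM y z)
    have hs := cl_mono (off_subset A S) y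
    exact mul_le_mul (Finset.sum_le_sum_of_subset_of_nonneg hs fun s _ _ => tau_nonneg h0 h1' _ _)
      (phi_mono g0 g1 (Finset.card_le_card hs)) (phi_nonneg g0 g1 _)
      (Finset.sum_nonneg fun s _ => tau_nonneg h0 h1' _ _)
  have c1 := mul_le_mul_of_nonneg_right b1 M0
  have c2 := mul_le_mul_of_nonneg_right b2 (mul_nonneg sz M0)
  have c3 := mul_le_mul_of_nonneg_right b3 M0
  change _ ≤ _ at c2
  nlinarith

lemma RR_lower (h0 : 0 ≤ p) (h1 : p ≤ 1 / 2) (g0 : 0 < γ) (g1 : γ ≤ 1)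
    (hM : ∀ x, Ex E p (fun S => phi γ (cl S x).card) = M) (w y z : V) :
    M ^ 2 * (Ex E p (fun S => fn γ (cl S w).card) * (1 - tri E p y z) -
      M / γ * (tri E p w y + tri E p w z)) ≤ RR E p γ w y z := by
  have h1' : p ≤ 1 := by linarith
  unfold RR
  have e1 : ∀ S : Finset (Sym2 V), fn γ (cl S w).card * phi γ (cl S y).card * phi γ (cl S z).card *
      ind (y ∉ cl S w ∧ z ∉ cl S w ∧ z ∉ cl S y) =
      (fun (A : Finset V) (X : Finset (Sym2 V)) => fn γ A.card * ind (y ∉ A ∧ z ∉ A) *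
        (phi γ (cl X y).card * phi γ (cl X z).card * ind (z ∉ cl X y))) (cl S w)
        (off (cl S w) S) := by
    intro S
    simp only []
    by_cases hA : y ∉ cl S w ∧ z ∉ cl S w
    · rw [cl_off_eq (y := y), cl_off_eq (y := z), ind_true hA]
      · simp only [hA, not_false_eq_true, true_and]
        ring
      · intro s hs hs'
        exact hA.2 (cl_trans hs (cl_comm.1 hs'))
      · intro s hs hs'
        exact hA.1 (cl_trans hs (cl_comm.1 hs'))
    · rw [ind_false hA, ind_false (fun h => hA ⟨h.1, h.2.1⟩)]; ring
  rw [Ex_dec (fun (A : Finset V) (X : Finset (Sym2 V)) => fn γ A.card * ind (y ∉ A ∧ z ∉ A) *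
        (phi γ (cl X y).card * phi γ (cl X z).card * ind (z ∉ cl X y))) e1]
  simp only [Ex_const_mul]
  have e2 : ∀ S : Finset (Sym2 V), fn γ (cl S w).card * (M ^ 2 * (1 - ∑ s ∈ cl S w, tau E p y s -
      ∑ s ∈ cl S w, tau E p z s - tri E p y z)) ≤
      fn γ (cl S w).card * ind (y ∉ cl S w ∧ z ∉ cl S w) *
        Ex E p (fun S2 => phi γ (cl (off (cl S w) S2) y).card * phi γ (cl (off (cl S w) S2) z).card *
        ind (z ∉ cl (off (cl S w) S2) y)) := by
    intro S
    rw [mul_assoc]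
    exact mul_le_mul_of_nonneg_left (inner_lower h0 h1 g0.le g1 hM (cl S w) y z) (fn_nonneg g1 _)
  refine le_trans ?_ (Ex_mono h0 h1' fun S _ => e2 S)
  have b : ∀ y, Ex E p (fun S => (∑ s ∈ cl S w, tau E p y s) * fn γ (cl S w).card) ≤
      M / γ * tri E p w y := by
    intro y
    have := bound_B2sum h0 h1 g0.le g1 hM w y
    rw [div_mul_eq_mul_div, le_div_iff₀ g0, ← Ex_mul_const, mul_comm M]
    refine le_trans (Ex_mono h0 h1' fun S _ => ?_) this
    have h2 := mul_le_mul_of_nonneg_left (fn_le_phi g0.le g1 (cl S w).card)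
      (Finset.sum_nonneg fun s (_ : s ∈ cl S w) => tau_nonneg (E := E) h0 h1' y s)
    linarith
  have e3 : Ex E p (fun S => fn γ (cl S w).card * (M ^ 2 * (1 - ∑ s ∈ cl S w, tau E p y s -
      ∑ s ∈ cl S w, tau E p z s - tri E p y z))) =
      M ^ 2 * (Ex E p (fun S => fn γ (cl S w).card) * (1 - tri E p y z) -
      (Ex E p (fun S => (∑ s ∈ cl S w, tau E p y s) * fn γ (cl S w).card) +
       Ex E p (fun S => (∑ s ∈ cl S w, tau E p z s) * fn γ (cl S w).card))) := by
    rw [← Ex_add, ← Ex_mul_const, ← Ex_sub, ← Ex_const_mul]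
    congr 1
    ext S
    ring
  rw [e3]
  refine mul_le_mul_of_nonneg_left ?_ (sq_nonneg M)
  have := b y
  have := b z
  linarith

end lower
end PercAux

namespace PercAux
set_option linter.unusedSectionVars false

section mainineq
variable {V : Type*} [Fintype V]

/-- transitive regular loopless bond sets -/
structure TrReg (E : Finset (Sym2 V)) (Ω : ℕ) : Prop where
  reg : ∀ w, (Finset.univ.filter (fun y => s(w, y) ∈ E)).card = Ω
  loop : ∀ w, s(w, w) ∉ E
  trans : ∀ x y : V, ∃ σ : V ≃ V, (∀ a b, s(a, b) ∈ E ↔ s(σ a, σ b) ∈ E) ∧ σ x = y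

variable {E : Finset (Sym2 V)} {Ω : ℕ} {p γ : ℝ}

/-- expectation of a function of the cluster size of `x` -/
def Q (E : Finset (Sym2 V)) (p : ℝ) (x : V) (g : ℕ → ℝ) : ℝ := Ex E p (fun S => g (cl S x).card)

lemma TrReg.Q_eq (hE : TrReg E Ω) (x y : V) (g : ℕ → ℝ) : Q E p x g = Q E p y g := by
  obtain ⟨σ, h1, h2⟩ := hE.trans x y
  unfold Q
  rw [Ex_transport E p σ h1 (fun S => g (cl S y).card)]
  congr 1
  ext S
  rw [← h2, cl_map, Finset.card_map]

lemma pair_count (hE : TrReg E Ω) (w : V) :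
    ∑ y, ∑ z, ind (s(w, y) ∈ E ∧ s(w, z) ∈ E ∧ y ≠ z) = (Ω : ℝ) * (Ω - 1) := by
  have h : ∀ y z, ind (s(w, y) ∈ E ∧ s(w, z) ∈ E ∧ y ≠ z) =
      ind (s(w, y) ∈ E) * ind (s(w, z) ∈ E) - ind (s(w, y) ∈ E) * (if y = z then 1 else 0) := by
    intro y z
    rw [ind_and, ind_and]
    by_cases hyz : y = z
    · subst hyz
      by_cases h1 : s(w, y) ∈ E <;> simp [ind, h1]
    · simp [ind, hyz]
  have hc : ∑ y, ind (s(w, y) ∈ E) = (Ω : ℝ) := by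
    rw [← hE.reg w, ← sum_ind_mem]
    refine Finset.sum_congr rfl fun y _ => ?_
    congr 1
    simp
  simp only [h, Finset.sum_sub_distrib]
  simp only [← Finset.mul_sum, ← Finset.sum_mul, hc]
  simp only [Finset.sum_ite_eq, Finset.mem_univ, if_true, mul_one, hc]
  ring

lemma fn_eq (γ : ℝ) (n : ℕ) : fn γ n = (1 - γ) * (n * (1 - γ) ^ (n - 1)) := by
  unfold fn
  rcases n with _ | n
  · simp
  · simp [pow_succ]; ring

lemma Q_nonneg (h0 : 0 ≤ p) (h1 : p ≤ 1) (x : V) {g : ℕ → ℝ} (hg : ∀ n, 0 ≤ g n) :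
    0 ≤ Q E p x g := Ex_nonneg h0 h1 fun _ _ => hg _

lemma Q_mono (h0 : 0 ≤ p) (h1 : p ≤ 1) (x : V) {g g' : ℕ → ℝ} (hg : ∀ n, g n ≤ g' n) :
    Q E p x g ≤ Q E p x g' := Ex_mono h0 h1 fun _ _ => hg _

lemma main_ineq (hE : TrReg E Ω) (h0 : 0 ≤ p) (h1 : p ≤ 1 / 2) (g0 : 0 < γ) (g1 : γ ≤ 1)
    (x : V) {b : ℝ} (hb : ∀ x y, x ≠ y → tri E p x y ≤ b) :
    p ^ 2 * ((Ω : ℝ) * (Ω - 1)) * ((Q E p x (phi γ)) ^ 2 * (Q E p x (fn γ) * (1 - b) -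
      Q E p x (phi γ) / γ * (2 * b))) ≤
      2 * (Q E p x (phi γ) - γ * Q E p x (fun n => n * (1 - γ) ^ (n - 1))) := by
  have h1' : p ≤ 1 := by linarith
  set M := Q E p x (phi γ) with hMdef
  set D := Q E p x (fn γ) with hDdef
  set M1 := Q E p x (fun n => n * (1 - γ) ^ (n - 1)) with hM1
  have M0 : 0 ≤ M := Q_nonneg h0 h1' x (phi_nonneg g0.le g1)
  have D0 : 0 ≤ D := Q_nonneg h0 h1' x (fn_nonneg g1)
  have hM : ∀ x, Ex E p (fun S => phi γ (cl S x).card) = M := fun x' => hE.Q_eq x' x (phi γ)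
  have up := main_upper (E := E) h0 h1' g0.le g1
  have e1 : ∀ x' : V, 2 * Ex E p (fun S => phi γ (cl S x').card -
        (cl S x').card * γ * (1 - γ) ^ ((cl S x').card - 1)) = 2 * (M - γ * M1) := by
    intro x'
    rw [Ex_sub, hM, hM1, hE.Q_eq x x', Q, ← Ex_const_mul]
    congr 2
    congr 1
    ext S
    ring
  simp only [e1, Finset.sum_const, nsmul_eq_mul] at up
  have low : ∀ w : V, (Ω : ℝ) * (Ω - 1) * (M ^ 2 * (D * (1 - b) - M / γ * (2 * b))) ≤
      ∑ y, ∑ z, ind (s(w, y) ∈ E ∧ s(w, z) ∈ E ∧ y ≠ z) * RR E p γ w y z := by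
    intro w
    rw [← pair_count hE w, Finset.sum_mul]
    refine Finset.sum_le_sum fun y _ => ?_
    rw [Finset.sum_mul]
    refine Finset.sum_le_sum fun z _ => ?_
    by_cases h : s(w, y) ∈ E ∧ s(w, z) ∈ E ∧ y ≠ z
    · refine mul_le_mul_of_nonneg_left ?_ (ind_nonneg _)
      refine le_trans ?_ (RR_lower h0 h1 g0 g1 hM w y z)
      have hwy : w ≠ y := by rintro rfl; exact hE.loop _ h.1
      have hwz : w ≠ z := by rintro rfl; exact hE.loop _ h.2.1
      have b1 := hb w y hwy
      have b2 := hb w z hwz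
      have b3 := hb y z h.2.2
      refine mul_le_mul_of_nonneg_left ?_ (sq_nonneg M)
      have hD : Ex E p (fun S => fn γ (cl S w).card) = D := hE.Q_eq w x (fn γ)
      rw [hD]
      have hMg : 0 ≤ M / γ := by positivity
      have := mul_le_mul_of_nonneg_left b3 D0
      have := mul_le_mul_of_nonneg_left b1 hMg
      have := mul_le_mul_of_nonneg_left b2 hMg
      nlinarith
    · rw [ind_false h]; simp
  have low2 := mul_le_mul_of_nonneg_left (Finset.sum_le_sum fun w (_ : w ∈ Finset.univ) => low w)
    (sq_nonneg p)
  rw [Finset.sum_const, nsmul_eq_mul] at low2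
  have hV : (0 : ℝ) < (Finset.univ : Finset V).card := by
    have : 0 < (Finset.univ : Finset V).card := Finset.card_pos.2 ⟨x, Finset.mem_univ x⟩
    exact_mod_cast this
  have := low2.trans up
  refine le_of_mul_le_mul_left ?_ hV
  calc _ = _ := ?_
    _ ≤ _ := this
  ring

end mainineq
end PercAux

namespace PercAux
set_option linter.unusedSectionVars false

section sprinkle
variable {V : Type*} [Fintype V]
variable {E : Finset (Sym2 V)} {Ω : ℕ} {p q γ : ℝ}

lemma det_spr {S S' : Finset (Sym2 V)} {x y : V} (hy : y ∈ cl (S ∪ S') x) (hyA : y ∉ cl S x) :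
    ∃ a ∈ cl S x, ∃ w, (w ∉ cl S x ∧ s(a, w) ∈ S') ∧ y ∈ cl (off (cl S x) (S ∪ S')) w := by
  have : cl (S ∪ S') x ⊆ Finset.univ.filter (fun y => y ∈ cl S x ∨
      ∃ a ∈ cl S x, ∃ w, (w ∉ cl S x ∧ s(a, w) ∈ S') ∧ y ∈ cl (off (cl S x) (S ∪ S')) w) := by
    apply cl_subset
    · simp [cl_self]
    · intro u v hu huv
      rw [Finset.mem_filter] at hu ⊢
      refine ⟨Finset.mem_univ _, ?_⟩
      by_cases hv : v ∈ cl S x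
      · exact Or.inl hv
      · right
        rcases hu.2 with hu | ⟨a, ha, w, hw, hu⟩
        · rcases Finset.mem_union.1 huv with h | h
          · exact absurd (cl_step hu h) hv
          · exact ⟨u, hu, v, ⟨hv, h⟩, cl_self _ _⟩
        · exact ⟨a, ha, w, hw, cl_step hu (mem_off.2 ⟨huv, cl_off_disj hw.1 hu, hv⟩)⟩
  have h := (Finset.mem_filter.1 (this hy)).2
  exact h.resolve_left hyA

/-- Sum over sprinkled boundary bonds. -/
def Bd (S S' : Finset (Sym2 V)) (x : V) (h : ℕ → ℝ) : ℝ :=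
  ∑ a ∈ cl S x, ∑ w, ind (w ∉ cl S x ∧ s(a, w) ∈ S') *
    h (cl (off (cl S x) (S ∪ S')) w).card

lemma cover_bound {ι : Type*} (s : Finset ι) (K : ι → Finset V) {h : ℕ → ℝ}
    (hm : Monotone h) (h00 : h 0 = 0) (hs : ∀ m n, h (m + n) ≤ h m + h n) :
    h (s.biUnion K).card ≤ ∑ i ∈ s, h (K i).card := by
  induction s using Finset.induction_on with
  | empty => simp [h00]
  | insert a s ha ih =>
    rw [Finset.biUnion_insert, Finset.sum_insert ha]
    calc _ ≤ h ((K a).card + (s.biUnion K).card) := hm (Finset.card_union_le _ _)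
      _ ≤ _ := (hs _ _).trans (by gcongr)

/-- the index set of boundary bonds -/
def Pr (S S' : Finset (Sym2 V)) (x : V) : Finset (V × V) :=
  (cl S x ×ˢ Finset.univ).filter (fun t => t.2 ∉ cl S x ∧ s(t.1, t.2) ∈ S')

lemma Bd_eq (S S' : Finset (Sym2 V)) (x : V) (h : ℕ → ℝ) :
    Bd S S' x h = ∑ t ∈ Pr S S' x, h (cl (off (cl S x) (S ∪ S')) t.2).card := by
  unfold Bd Pr
  rw [Finset.sum_filter, Finset.sum_product]
  refine Finset.sum_congr rfl fun a _ => Finset.sum_congr rfl fun w _ => ?_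
  unfold ind
  split_ifs <;> simp

lemma new_sub (S S' : Finset (Sym2 V)) (x : V) : cl (S ∪ S') x \ cl S x ⊆
    (Pr S S' x).biUnion (fun t => cl (off (cl S x) (S ∪ S')) t.2) := by
  intro y hy
  rw [Finset.mem_sdiff] at hy
  obtain ⟨a, ha, w, hw, hyw⟩ := det_spr hy.1 hy.2
  rw [Finset.mem_biUnion]
  exact ⟨(a, w), by simp [Pr, ha, hw], hyw⟩

lemma new_bound (S S' : Finset (Sym2 V)) (x : V) {h : ℕ → ℝ}
    (hm : Monotone h) (h00 : h 0 = 0) (hs : ∀ m n, h (m + n) ≤ h m + h n) :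
    h (cl (S ∪ S') x \ cl S x).card ≤ Bd S S' x h := by
  rw [Bd_eq]
  exact (hm (Finset.card_le_card (new_sub S S' x))).trans (cover_bound _ _ hm h00 hs)

lemma card_split (S S' : Finset (Sym2 V)) (x : V) :
    (cl (S ∪ S') x).card = (cl S x).card + (cl (S ∪ S') x \ cl S x).card := by
  rw [add_comm]
  exact (Finset.card_sdiff_add_card_eq_card (cl_mono (by
    intro e he; exact Finset.mem_union_left _ he) x)).symm

lemma cast_mono : Monotone (fun n : ℕ => (n : ℝ)) := fun _ _ h => Nat.cast_le.2 h

lemma phi_add (γ : ℝ) (m n : ℕ) : phi γ (m + n) = phi γ m + (1 - γ) ^ m * phi γ n := by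
  unfold phi; rw [pow_add]; ring

lemma phi_sub (g0 : 0 ≤ γ) (g1 : γ ≤ 1) (m n : ℕ) : phi γ (m + n) ≤ phi γ m + phi γ n := by
  rw [phi_add]
  have h1 : (1 - γ) ^ m ≤ 1 := pow_le_one₀ (by linarith) (by linarith)
  have := phi_nonneg g0 g1 n
  nlinarith

lemma pt_i (S S' : Finset (Sym2 V)) (x : V) :
    ((cl (S ∪ S') x).card : ℝ) ≤ (cl S x).card + 1 * Bd S S' x (fun n => (n : ℝ)) := by
  rw [card_split, one_mul]
  push_cast
  gcongr
  exact new_bound S S' x cast_mono (by simp) (fun m n => by push_cast; exact le_rfl)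

lemma pt_ii (g0 : 0 ≤ γ) (g1 : γ ≤ 1) (S S' : Finset (Sym2 V)) (x : V) :
    phi γ (cl (S ∪ S') x).card ≤ phi γ (cl S x).card +
      (1 - γ) ^ (cl S x).card * Bd S S' x (phi γ) := by
  rw [card_split, phi_add]
  have : 0 ≤ (1 - γ) ^ (cl S x).card := pow_nonneg (by linarith) _
  gcongr
  exact new_bound S S' x (fun _ _ h => phi_mono g0 g1 h) (by simp [phi]) (phi_sub g0 g1)

lemma pt_iii (g0 : 0 < γ) (g1 : γ ≤ 1) (S S' : Finset (Sym2 V)) (x : V) :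
    ((cl (S ∪ S') x).card : ℝ) ≤ (cl S x).card +
      (1 - γ) ^ (cl S x).card * Bd S S' x (fun n => (n : ℝ)) +
      ∑ y, phi γ (cl S x).card * phi γ (cl (off (cl S x) (S ∪ S')) y).card +
      1 * Bd S S' x (fun n => phi γ n / γ) := by
  rw [card_split]
  push_cast
  set N := cl (S ∪ S') x \ cl S x with hN
  have r0 : 0 ≤ (1 - γ) ^ (cl S x).card := pow_nonneg (by linarith) _
  have f0 := phi_nonneg g0.le g1 (cl S x).card
  have f1 := phi_le_one g1 (cl S x).card
  have e : (N.card : ℝ) = (1 - γ) ^ (cl S x).card * N.card + phi γ (cl S x).card * N.card := by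
    unfold phi; ring
  have b1 : (N.card : ℝ) ≤ Bd S S' x (fun n => (n : ℝ)) :=
    new_bound S S' x cast_mono (by simp) (fun m n => by push_cast; exact le_rfl)
  have b2 : (N.card : ℝ) ≤ ∑ y, phi γ (cl (off (cl S x) (S ∪ S')) y).card +
      ∑ y ∈ N, (1 - γ) ^ (cl (off (cl S x) (S ∪ S')) y).card := by
    have : (N.card : ℝ) = ∑ y ∈ N, (phi γ (cl (off (cl S x) (S ∪ S')) y).card +
      (1 - γ) ^ (cl (off (cl S x) (S ∪ S')) y).card) := by
      simp [phi]
    rw [this, Finset.sum_add_distrib]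
    gcongr
    · exact fun y _ _ => phi_nonneg g0.le g1 _
    · exact Finset.subset_univ N
  have b3 : ∑ y ∈ N, (1 - γ) ^ (cl (off (cl S x) (S ∪ S')) y).card ≤
      Bd S S' x (fun n => phi γ n / γ) := by
    rw [Bd_eq]
    calc ∑ y ∈ N, (1 - γ) ^ (cl (off (cl S x) (S ∪ S')) y).card ≤
        ∑ y ∈ N, ∑ t ∈ Pr S S' x, (if y ∈ cl (off (cl S x) (S ∪ S')) t.2 then
          (1 - γ) ^ (cl (off (cl S x) (S ∪ S')) t.2).card else 0) := by
          refine Finset.sum_le_sum fun y hy => ?_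
          obtain ⟨t, ht, hyt⟩ := Finset.mem_biUnion.1 (new_sub S S' x hy)
          refine le_trans (le_of_eq ?_) (Finset.single_le_sum (f := fun t : V × V =>
            (if y ∈ cl (off (cl S x) (S ∪ S')) t.2 then
            (1 - γ) ^ (cl (off (cl S x) (S ∪ S')) t.2).card else 0)) (fun t _ => ?_) ht)
          · simp only [hyt, if_true]
            rw [cl_eq hyt]
          · split_ifs
            · exact pow_nonneg (by linarith) _
            · exact le_rfl
      _ ≤ _ := by
          rw [Finset.sum_comm]
          refine Finset.sum_le_sum fun t _ => ?_
          rw [le_div_iff₀ g0, mul_comm]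
          refine le_trans ?_ (fn_le_phi g0.le g1 _)
          refine mul_le_mul_of_nonneg_left ?_ g0.le
          rw [← Finset.sum_filter, Finset.sum_const, nsmul_eq_mul, fn]
          refine mul_le_mul_of_nonneg_right ?_ (pow_nonneg (by linarith) _)
          exact Nat.cast_le.2 (Finset.card_le_card (by intro y; simp))
  have b4 : 0 ≤ ∑ y ∈ N, (1 - γ) ^ (cl (off (cl S x) (S ∪ S')) y).card :=
    Finset.sum_nonneg fun y _ => pow_nonneg (by linarith) _
  rw [← Finset.mul_sum]
  have c1 := mul_le_mul_of_nonneg_left b1 r0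
  have c2 := mul_le_mul_of_nonneg_left b2 f0
  have c3 := mul_le_of_le_one_left b4 f1
  nlinarith

lemma Ex_single (E : Finset (Sym2 V)) (q : ℝ) (e : Sym2 V) :
    Ex E q (fun S => ind (e ∈ S)) = ind (e ∈ E) * q := by
  by_cases he : e ∈ E
  · obtain ⟨I, hI, rfl⟩ : ∃ I, e ∉ I ∧ E = insert e I :=
      ⟨E.erase e, by simp, (Finset.insert_erase he).symm⟩
    rw [ind_true (by simp), one_mul]
    have h1 := Ex_insert hI q (fun S => ind (e ∈ S))
    have h2 : Ex I q (fun S => ind (e ∈ S)) = 0 := by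
      rw [Ex_congr (g := fun _ => 0) (fun S hS => ind_false fun h => hI (hS h)), Ex_const]
    have h3 : Ex I q (fun S => ind (e ∈ insert e S)) = 1 := by
      rw [Ex_congr (g := fun _ => 1) (fun S hS => ind_true (by simp)), Ex_const]
    rw [h2] at h1
    convert h1 using 1
    · congr 1
      ext e'; simp
    · rw [mul_zero, zero_add]
      conv_lhs => rw [← mul_one q, ← h3]
      congr 2
      ext S
      rw [ind_true (by simp), ind_true (by simp)]
  · rw [Ex_congr (g := fun _ => 0) (fun S hS => ind_false fun h => he (hS h)), Ex_const,
      ind_false he, zero_mul]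

lemma off_union (A : Finset V) (S S' : Finset (Sym2 V)) : off A (S ∪ S') = off A S ∪ off A S' := by
  unfold off
  rw [Finset.filter_union]

lemma merge_off (p0 : 0 ≤ p) (p1 : p ≤ 1) (q0 : 0 ≤ q) (q1 : q ≤ 1) (A : Finset V) (w : V)
    {h : ℕ → ℝ} (hm : Monotone h) :
    Ex E p (fun S => Ex E q (fun S' => h (cl (off A (S ∪ S')) w).card)) ≤
      Q E (p + q - p * q) w h := by
  have := Ex_merge E p q (fun U => h (cl (off A U) w).card)
  have e : Ex E p (fun S => Ex E q (fun S' => h (cl (off A (S ∪ S')) w).card)) =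
    Ex E (p + q - p * q) (fun U => h (cl (off A U) w).card) := by
    rw [← this]
    congr 1
    ext S
    congr 1
    ext S'
    congr 4
    ext e; simp
  rw [e]
  refine Ex_mono (by nlinarith) (by nlinarith) fun U _ => ?_
  exact hm (Finset.card_le_card (cl_mono (off_subset A U) w))

lemma merge_Q (x : V) (h : ℕ → ℝ) :
    Ex E p (fun S => Ex E q (fun S' => h (cl (S ∪ S') x).card)) =
      Q E (p + q - p * q) x h := by
  have := Ex_merge E p q (fun U => h (cl U x).card)
  rw [Q, ← this]
  congr 1
  ext S
  congr 1
  ext S'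
  congr 3
  ext e; simp

lemma spr_far (hE : TrReg E Ω) (p0 : 0 ≤ p) (p1 : p ≤ 1) (q0 : 0 ≤ q) (q1 : q ≤ 1) (x y : V)
    {F h : ℕ → ℝ} (hF : ∀ n, 0 ≤ F n) (hm : Monotone h) :
    Ex E p (fun S => Ex E q (fun S' => F (cl S x).card *
      h (cl (off (cl S x) (S ∪ S')) y).card)) ≤ Q E p x F * Q E (p + q - p * q) x h := by
  simp only [off_union]
  rw [Ex_dec (w := x) (fun A X => Ex E q (fun S' => F A.card *
      h (cl (X ∪ off A S') y).card)) (fun S => rfl)]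
  simp only [Ex_const_mul, ← off_union]
  rw [Q, ← Ex_mul_const]
  refine Ex_mono p0 p1 fun S _ => mul_le_mul_of_nonneg_left ?_ (hF _)
  rw [hE.Q_eq x y]
  exact merge_off p0 p1 q0 q1 (cl S x) y hm

lemma spr_bd (hE : TrReg E Ω) (p0 : 0 ≤ p) (p1 : p ≤ 1) (q0 : 0 ≤ q) (q1 : q ≤ 1) (x : V)
    {F h : ℕ → ℝ} (hF : ∀ n, 0 ≤ F n) (hm : Monotone h) (h0 : ∀ n, 0 ≤ h n) :
    Ex E p (fun S => Ex E q (fun S' => F (cl S x).card * Bd S S' x h)) ≤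
      Q E p x (fun n => F n * n) * (Ω * q * Q E (p + q - p * q) x h) := by
  unfold Bd
  simp only [off_union]
  rw [Ex_dec (w := x) (fun A X => Ex E q (fun S' => F A.card * ∑ a ∈ A, ∑ w,
      ind (w ∉ A ∧ s(a, w) ∈ S') * h (cl (X ∪ off A S') w).card)) (fun S => rfl)]
  simp only [Ex_const_mul, ← off_union]
  rw [Q, ← Ex_mul_const]
  refine Ex_mono p0 p1 fun S _ => ?_
  rw [mul_assoc]
  refine mul_le_mul_of_nonneg_left ?_ (hF _)
  generalize cl S x = A
  simp only [Ex_sum]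
  set H := Q E (p + q - p * q) x h with hH
  have H0 : 0 ≤ H := Q_nonneg (by nlinarith) (by nlinarith) x h0
  have key : ∀ a ∈ A, ∀ w, Ex E p (fun S2 => Ex E q (fun S' =>
      ind (w ∉ A ∧ s(a, w) ∈ S') * h (cl (off A (S2 ∪ S')) w).card)) ≤
      ind (s(a, w) ∈ E) * (q * H) := by
    intro a ha w
    have i1 : ∀ S2, Ex E q (fun S' =>
      ind (w ∉ A ∧ s(a, w) ∈ S') * h (cl (off A (S2 ∪ S')) w).card) ≤
      ind (s(a, w) ∈ E) * q * Ex E q (fun S' => h (cl (off A (S2 ∪ S')) w).card) := by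
      intro S2
      rw [← Ex_single]
      have := Ex_indep (touch A) E q (fun X => ind (s(a, w) ∈ X))
        (fun X => h (cl (off A S2 ∪ X) w).card)
      have t : ∀ S' : Finset (Sym2 V), ind (s(a, w) ∈ S'.filter (touch A)) = ind (s(a, w) ∈ S') := by
        intro S'
        congr 1
        rw [Finset.mem_filter]
        have : touch A s(a, w) := ⟨a, ha, by simp⟩
        simp [this]
      simp only [t] at this
      calc Ex E q (fun S' => ind (w ∉ A ∧ s(a, w) ∈ S') * h (cl (off A (S2 ∪ S')) w).card) ≤
          Ex E q (fun S' => ind (s(a, w) ∈ S') * h (cl (off A (S2 ∪ S')) w).card) :=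
            Ex_mono q0 q1 fun S' _ => mul_le_mul_of_nonneg_right (ind_mono fun h => h.2) (h0 _)
        _ = _ := by
            simp only [off_union]
            exact this
    refine (Ex_mono p0 p1 fun S2 _ => i1 S2).trans ?_
    rw [Ex_const_mul, mul_assoc]
    refine mul_le_mul_of_nonneg_left (mul_le_mul_of_nonneg_left ?_ q0) (ind_nonneg _)
    rw [hH, hE.Q_eq x w]
    exact merge_off p0 p1 q0 q1 A w hm
  calc _ ≤ ∑ a ∈ A, ∑ w, ind (s(a, w) ∈ E) * (q * H) :=
        Finset.sum_le_sum fun a ha => Finset.sum_le_sum fun w _ => key a ha w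
    _ = ∑ a ∈ A, (Ω : ℝ) * (q * H) := by
        refine Finset.sum_congr rfl fun a _ => ?_
        rw [← Finset.sum_mul]
        congr 1
        rw [← hE.reg a, ← sum_ind_mem]
        refine Finset.sum_congr rfl fun y _ => ?_
        congr 1
        simp
    _ = _ := by
        rw [Finset.sum_const, nsmul_eq_mul]; ring

lemma spr_i (hE : TrReg E Ω) (p0 : 0 ≤ p) (p1 : p ≤ 1) (q0 : 0 ≤ q) (q1 : q ≤ 1) (x : V) :
    Q E (p + q - p * q) x (fun n => (n : ℝ)) ≤ Q E p x (fun n => (n : ℝ)) +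
      Q E p x (fun n => (n : ℝ)) * (Ω * q * Q E (p + q - p * q) x (fun n => (n : ℝ))) := by
  have h := spr_bd hE p0 p1 q0 q1 x (F := fun _ => 1) (fun _ => zero_le_one) cast_mono
    (fun n => Nat.cast_nonneg n)
  have h2 := Ex_mono (I := E) p0 p1 fun S _ => Ex_mono (I := E) q0 q1 fun S' _ => pt_i S S' x
  rw [merge_Q x (fun n => (n : ℝ))] at h2
  simp only [Ex_add, Ex_const, one_mul] at h2 h
  unfold Q at *
  linarith

lemma spr_ii (hE : TrReg E Ω) (p0 : 0 ≤ p) (p1 : p ≤ 1) (q0 : 0 ≤ q) (q1 : q ≤ 1)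
    (g0 : 0 ≤ γ) (g1 : γ ≤ 1) (x : V) :
    Q E (p + q - p * q) x (phi γ) ≤ Q E p x (phi γ) +
      Q E p x (fn γ) * (Ω * q * Q E (p + q - p * q) x (phi γ)) := by
  have h := spr_bd hE p0 p1 q0 q1 x (F := fun n => (1 - γ) ^ n) (fun _ => pow_nonneg (by linarith) _)
    (h := phi γ) (fun _ _ h => phi_mono g0 g1 h) (phi_nonneg g0 g1)
  have h2 := Ex_mono (I := E) p0 p1 fun S _ => Ex_mono (I := E) q0 q1 fun S' _ => pt_ii g0 g1 S S' x
  rw [merge_Q x (phi γ)] at h2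
  simp only [Ex_add, Ex_const] at h2 h
  have e : Q E p x (fun n => (1 - γ) ^ n * n) = Q E p x (fn γ) := by
    congr 1; ext n; unfold fn; ring
  rw [e] at h
  unfold Q at *
  linarith

lemma spr_iii (hE : TrReg E Ω) (p0 : 0 ≤ p) (p1 : p ≤ 1) (q0 : 0 ≤ q) (q1 : q ≤ 1)
    (g0 : 0 < γ) (g1 : γ ≤ 1) (x : V) :
    Q E (p + q - p * q) x (fun n => (n : ℝ)) ≤ Q E p x (fun n => (n : ℝ)) +
      Q E p x (fn γ) * (Ω * q * Q E (p + q - p * q) x (fun n => (n : ℝ))) +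
      Fintype.card V * (Q E p x (phi γ) * Q E (p + q - p * q) x (phi γ)) +
      Q E p x (fun n => (n : ℝ)) * (Ω * q * (Q E (p + q - p * q) x (phi γ) / γ)) := by
  have h := spr_bd hE p0 p1 q0 q1 x (F := fun n => (1 - γ) ^ n) (fun _ => pow_nonneg (by linarith) _)
    cast_mono (fun n => Nat.cast_nonneg n)
  have h' := spr_bd hE p0 p1 q0 q1 x (F := fun _ => 1) (fun _ => zero_le_one)
    (h := fun n => phi γ n / γ) (fun _ _ h => by
      have := phi_mono g0.le g1 h
      dsimp only
      gcongr) (fun n => div_nonneg (phi_nonneg g0.le g1 n) g0.le)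
  have h3 := fun y => spr_far hE p0 p1 q0 q1 x y (F := phi γ) (h := phi γ) (phi_nonneg g0.le g1)
    (fun _ _ h => phi_mono g0.le g1 h)
  have h2 := Ex_mono (I := E) p0 p1 fun S _ => Ex_mono (I := E) q0 q1 fun S' _ => pt_iii g0 g1 S S' x
  rw [merge_Q x (fun n => (n : ℝ))] at h2
  simp only [Ex_add, Ex_const, Ex_sum, one_mul] at h2 h h'
  have h4 := Finset.sum_le_sum fun y (_ : y ∈ (Finset.univ : Finset V)) => h3 y
  rw [Finset.sum_const, nsmul_eq_mul] at h4
  have e : Q E p x (fun n => (1 - γ) ^ n * n) = Q E p x (fn γ) := by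
    congr 1; ext n; unfold fn; ring
  have e2 : Q E (p + q - p * q) x (fun n => phi γ n / γ) = Q E (p + q - p * q) x (phi γ) / γ := by
    unfold Q
    rw [div_eq_mul_inv, ← Ex_mul_const]
    congr 1
  rw [e] at h
  rw [e2] at h'
  have e3 : (Finset.univ : Finset V).card = Fintype.card V := rfl
  rw [e3] at h4
  unfold Q at *
  linarith

end sprinkle
end PercAux

namespace PercAux
set_option linter.unusedSectionVars false

section analysis
variable {V : Type*} [Fintype V]
variable {E : Finset (Sym2 V)} {Ω : ℕ} {p q γ : ℝ}

/-- derivative of `phi` in `γ` -/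
def dphi (γ : ℝ) (n : ℕ) : ℝ := n * (1 - γ) ^ (n - 1)

lemma Q_deriv (E : Finset (Sym2 V)) (p : ℝ) (x : V) (γ : ℝ) :
    HasDerivAt (fun γ => Q E p x (phi γ)) (Q E p x (dphi γ)) γ := by
  unfold Q Ex
  refine HasDerivAt.fun_sum fun S _ => ?_
  refine HasDerivAt.const_mul _ ?_
  unfold phi dphi
  have h1 : HasDerivAt (fun γ : ℝ => 1 - γ) (-1) γ := by
    simpa using (hasDerivAt_id γ).const_sub 1
  have h2 := (h1.pow (cl S x).card).const_sub 1
  refine h2.congr_deriv ?_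
  ring

lemma dphi_le (g0 : 0 ≤ γ) (g1 : γ ≤ 1) (n : ℕ) : γ * dphi γ n ≤ phi γ n := by
  have hp : phi γ n = γ * ∑ i ∈ Finset.range n, (1 - γ) ^ i := by
    unfold phi
    have := mul_neg_geom_sum (1 - γ) n
    linarith
  rw [hp]
  refine mul_le_mul_of_nonneg_left ?_ g0
  have : dphi γ n = ∑ i ∈ Finset.range n, (1 - γ) ^ (n - 1) := by
    simp [dphi]
  rw [this]
  refine Finset.sum_le_sum fun i hi => ?_
  refine pow_le_pow_of_le_one (by linarith) (by linarith) ?_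
  have := Finset.mem_range.1 hi
  omega

lemma dphi_nonneg (g1 : γ ≤ 1) (n : ℕ) : 0 ≤ dphi γ n :=
  mul_nonneg (Nat.cast_nonneg n) (pow_nonneg (by linarith) _)

lemma Q_const_mul (c : ℝ) (x : V) (g : ℕ → ℝ) : Q E p x (fun n => c * g n) = c * Q E p x g := by
  unfold Q; rw [Ex_const_mul]

lemma le_tau (h0 : 0 ≤ p) (h1 : p ≤ 1) {x y : V} (h : s(x, y) ∈ E) : p ≤ tau E p x y := by
  have := Ex_single E p s(x, y)
  rw [ind_true h, one_mul] at this
  calc p = _ := this.symm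
    _ ≤ _ := Ex_mono h0 h1 fun S _ => ind_mono fun h => cl_step (cl_self S x) h

lemma sum_tau (x : V) : ∑ y, tau E p x y = Q E p x (fun n => (n : ℝ)) := by
  unfold tau Q
  rw [← Ex_sum]
  congr 1
  ext S
  exact sum_ind_mem _

lemma sum_tri (hE : TrReg E Ω) (x : V) : ∑ y, tri E p x y = (Q E p x (fun n => (n : ℝ))) ^ 3 := by
  set X := Q E p x (fun n => (n : ℝ)) with hX
  have h : ∀ v, ∑ y, tau E p v y = X := fun v => by rw [sum_tau, hX]; exact hE.Q_eq v x _
  unfold tri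
  rw [Finset.sum_comm]
  calc _ = ∑ u, ∑ v, tau E p x u * tau E p u v * X := by
        refine Finset.sum_congr rfl fun u _ => ?_
        rw [Finset.sum_comm]
        refine Finset.sum_congr rfl fun v _ => ?_
        rw [← Finset.mul_sum, h]
    _ = X ^ 3 := by
        simp only [← Finset.sum_mul, ← Finset.mul_sum, h]
        ring

lemma Q_zero (x : V) : Q E 0 x (fun n => (n : ℝ)) = 1 := by
  unfold Q
  rw [Ex_zero]
  have : cl ∅ x = {x} := by
    apply Finset.Subset.antisymm
    · exact cl_subset (by simp) (by simp)
    · simp [cl_self]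
  simp [this]

/-- The critical data. -/
structure Crit (E : Finset (Sym2 V)) (Ω : ℕ) (p : ℝ) (x : V) : Prop where
  tr : TrReg E Ω
  p0 : 0 < p
  p1 : p < 1
  big : 1000 ≤ Q E p x (fun n => (n : ℝ))
  tri : ∀ x y, tri E p x y ≤ (if x = y then 1 else 0) + 1 / 1000

variable {x : V}

lemma Crit.omega (h : Crit E Ω p x) : 999 / 1000 ≤ p * Ω := by
  have := spr_i h.tr le_rfl zero_le_one h.p0.le h.p1.le x
  rw [Q_zero] at this
  have hb := h.big
  simp only [zero_add, zero_mul, sub_zero, one_mul] at this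
  set X := Q E p x (fun n => (n : ℝ))
  by_contra hc
  push Not at hc
  nlinarith

lemma Crit.omega_pos (h : Crit E Ω p x) : 0 < Ω := by
  have := h.omega
  rcases Nat.eq_zero_or_pos Ω with h0 | h0
  · rw [h0] at this; norm_num at this
  · exact h0

lemma Crit.p_le (h : Crit E Ω p x) : p ≤ 1 / 1000 := by
  have h1 := h.omega_pos
  rw [← h.tr.reg x, Finset.card_pos] at h1
  obtain ⟨y, hy⟩ := h1
  have hy := (Finset.mem_filter.1 hy).2
  have hne : x ≠ y := by
    rintro rfl
    exact h.tr.loop _ hy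
  have := h.tri x y
  rw [if_neg hne] at this
  linarith [le_tau h.p0.le h.p1.le hy, tau_le_tri (E := E) h.p0.le h.p1.le x y]

lemma Crit.kappa (h : Crit E Ω p x) : 997 / 1000 ≤ p ^ 2 * ((Ω : ℝ) * (Ω - 1)) := by
  have h1 := h.omega
  have h2 := h.p_le
  nlinarith [mul_le_mul h1 (show 998 / 1000 ≤ p * Ω - p by linarith) (by norm_num) (by linarith)]

lemma Crit.cube (h : Crit E Ω p x) :
    (Q E p x (fun n => (n : ℝ))) ^ 3 ≤ 1 + 1 / 1000 * Fintype.card V := by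
  rw [← sum_tri h.tr]
  calc _ ≤ ∑ y, ((if x = y then (1:ℝ) else 0) + 1 / 1000) :=
        Finset.sum_le_sum fun y _ => h.tri x y
    _ = _ := by
        rw [Finset.sum_add_distrib, Finset.sum_ite_eq, Finset.sum_const, nsmul_eq_mul]
        simp [Finset.card_univ]; ring

lemma Crit.diffineq (h : Crit E Ω p x) (g0 : 0 < γ) (g1 : γ ≤ 3 / 100) :
    96 / 100 * (Q E p x (phi γ)) ^ 2 * Q E p x (dphi γ)
      ≤ 2 * (Q E p x (phi γ) - γ * Q E p x (dphi γ)) + (Q E p x (phi γ)) ^ 3 / γ * (2 / 1000) := by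
  have hm := main_ineq h.tr h.p0.le (by linarith [h.p_le]) g0 (by linarith) x
    (b := 1 / 1000) (fun x y hxy => by simpa [hxy] using h.tri x y)
  have hk := h.kappa
  have e : Q E p x (fn γ) = (1 - γ) * Q E p x (dphi γ) := by
    rw [← Q_const_mul]; congr 1; ext n; exact fn_eq γ n
  rw [e] at hm
  change _ ≤ 2 * (_ - γ * Q E p x (dphi γ)) at hm
  have M0 : 0 ≤ Q E p x (phi γ) := Q_nonneg h.p0.le h.p1.le x (phi_nonneg g0.le (by linarith))
  have N0 : 0 ≤ Q E p x (dphi γ) := Q_nonneg h.p0.le h.p1.le x (dphi_nonneg (by linarith))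
  have h0 : γ * Q E p x (dphi γ) ≤ Q E p x (phi γ) := by
    rw [← Q_const_mul]
    exact Q_mono h.p0.le h.p1.le x (dphi_le g0.le (by linarith))
  set M := Q E p x (phi γ)
  set N := Q E p x (dphi γ)
  set k := p ^ 2 * ((Ω : ℝ) * (Ω - 1))
  have hMg : 0 ≤ M / γ := div_nonneg M0 g0.le
  have e3 : M ^ 3 / γ = M ^ 2 * (M / γ) := by ring
  rw [e3]
  set R := M / γ
  have hMR : 0 ≤ M ^ 2 * R := by positivity
  by_cases hB : 0 ≤ (1 - γ) * N * (1 - 1 / 1000) - R * (2 * (1 / 1000))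
  · have := mul_le_mul_of_nonneg_right hk (mul_nonneg (sq_nonneg M) hB)
    have hγN : M ^ 2 * (γ * N) ≤ M ^ 2 * (3 / 100 * N) := by gcongr
    have : 0 ≤ M ^ 2 * N := by positivity
    nlinarith
  · push Not at hB
    have := mul_nonneg (sq_nonneg M) (sub_nonneg.2 hB.le)
    have hγN : M ^ 2 * (γ * N) ≤ M ^ 2 * (3 / 100 * N) := by gcongr
    have : 0 ≤ M ^ 2 * N := by positivity
    nlinarith

lemma Crit.sq_bound (h : Crit E Ω p x) (g0 : 0 ≤ γ) (g1 : γ ≤ 3 / 100) :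
    (Q E p x (phi γ)) ^ 2 ≤ 3 * γ := by
  have hd : ∀ g, HasDerivAt (fun γ => (Q E p x (phi γ)) ^ 2)
      (2 * Q E p x (phi g) * Q E p x (dphi g)) g := by
    intro g
    have := (Q_deriv E p x g).pow 2
    refine this.congr_deriv ?_
    norm_num
  have hB : ∀ g : ℝ, HasDerivAt (fun γ : ℝ => 3 * γ) 3 g := fun g => by
    simpa using (hasDerivAt_id g).const_mul 3
  have hz : Q E p x (phi 0) = 0 := by
    unfold Q phi; simp [Ex_const]
  refine image_le_of_deriv_right_lt_deriv_boundary (a := 0) (b := 3 / 100)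
    (f := fun γ => (Q E p x (phi γ)) ^ 2) (f' := fun g => 2 * Q E p x (phi g) * Q E p x (dphi g))
    (fun g _ => (hd g).continuousAt.continuousWithinAt)
    (fun g _ => (hd g).hasDerivWithinAt) (B := fun γ => 3 * γ) (B' := fun _ => 3)
    (by simp [hz]) hB ?_ ⟨g0, g1⟩
  rintro g ⟨hg0, hg1⟩ heq
  rcases hg0.eq_or_lt with rfl | hg
  · simp [hz]
  · have hm := h.diffineq hg hg1.le
    have M0 : 0 ≤ Q E p x (phi g) := Q_nonneg h.p0.le h.p1.le x (phi_nonneg hg0 (by linarith))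
    have e3 : (Q E p x (phi g)) ^ 3 / g = 3 * Q E p x (phi g) := by
      rw [pow_succ, heq]; field_simp
    rw [e3] at hm
    rw [heq] at hm
    set M := Q E p x (phi g)
    set N := Q E p x (dphi g)
    have h1 : g * N * 4.88 ≤ 2.006 * M := by nlinarith
    have h2 : g * (M * N) * 4.88 ≤ 2.006 * (3 * g) := by
      have := mul_le_mul_of_nonneg_right h1 M0
      nlinarith
    have h3 : (M * N) * 4.88 ≤ 2.006 * 3 := by
      by_contra hc
      push Not at hc
      nlinarith
    nlinarith

lemma Crit.D_bound (h : Crit E Ω p x) {s : ℝ} (s0 : 0 < s) (s1 : s ^ 2 ≤ 3 / 100) :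
    s * Q E p x (fn (s ^ 2)) ≤ 0.73 := by
  have g0 : 0 < s ^ 2 := by positivity
  have hm := h.diffineq g0 s1
  have hs := h.sq_bound g0.le s1
  have M0 : 0 ≤ Q E p x (phi (s^2)) := Q_nonneg h.p0.le h.p1.le x (phi_nonneg g0.le (by linarith))
  have N0 : 0 ≤ Q E p x (dphi (s^2)) := Q_nonneg h.p0.le h.p1.le x (dphi_nonneg (by linarith))
  have e : Q E p x (fn (s^2)) = (1 - s^2) * Q E p x (dphi (s^2)) := by
    rw [← Q_const_mul]; congr 1; ext n; exact fn_eq _ n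
  rw [e]
  set M := Q E p x (phi (s^2))
  set N := Q E p x (dphi (s^2))
  have e3 : M ^ 3 / s ^ 2 ≤ 3 * M := by
    rw [div_le_iff₀ g0]
    nlinarith
  have h1 : (2 * s ^ 2 + 96 / 100 * M ^ 2) * N ≤ 2.006 * M := by nlinarith
  have key : s * N ≤ 0.73 := by
    rcases M0.eq_or_lt with hM | hM
    · rw [← hM] at h1
      have : s * (s * N) ≤ 0 := by nlinarith
      have : s * N ≤ 0 := by
        by_contra hc
        push Not at hc
        nlinarith
      linarith
    · have h2 : 2.77 * (s * M) ≤ 2 * s ^ 2 + 96 / 100 * M ^ 2 := by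
        nlinarith [sq_nonneg (s - 0.6925 * M)]
      have h3 := (mul_le_mul_of_nonneg_right h2 N0).trans h1
      by_contra hc
      push Not at hc
      nlinarith
  nlinarith [mul_nonneg s0.le N0, mul_nonneg (mul_nonneg s0.le N0) g0.le]

end analysis
end PercAux

namespace PercAux
set_option linter.unusedSectionVars false

section core
variable {V : Type*} [Fintype V]
variable {E : Finset (Sym2 V)} {Ω : ℕ} {p : ℝ} {x : V}

lemma Crit.cube_le (h : Crit E Ω p x) :
    (Q E p x (fun n => (n : ℝ))) ^ 3 ≤ 2 / 1000 * Fintype.card V := by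
  have h1 := h.cube
  have h2 := h.big
  have : (1000:ℝ) ^ 3 ≤ (Q E p x (fun n => (n : ℝ))) ^ 3 := by gcongr
  linarith

set_option maxHeartbeats 1000000 in
lemma Crit.core (h : Crit E Ω p x) {ε p' : ℝ} (e0 : 0 ≤ ε) (hp' : p' = p + ε * (Ω : ℝ)⁻¹)
    (hp1 : p' ≤ 1) :
    Q E p' x (fun n => (n : ℝ)) ≤
      81 * (Q E p x (fun n => (n : ℝ)) + ε ^ 2 * Fintype.card V) := by
  have hΩ : (0:ℝ) < Ω := Nat.cast_pos.2 h.omega_pos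
  have p0 := h.p0
  have pl := h.p_le
  have p1 := h.p1
  have d0 : 0 < 1 - p := by linarith
  obtain ⟨q, hq⟩ : ∃ q, q = (p' - p) / (1 - p) := ⟨_, rfl⟩
  have hqm : q * (1 - p) = p' - p := by rw [hq]; field_simp
  have hpp : p + q - p * q = p' := by linarith
  have hdiff : 0 ≤ p' - p := by rw [hp']; simp; positivity
  have q0 : 0 ≤ q := by rw [hq]; positivity
  have q1 : q ≤ 1 := by rw [hq, div_le_one d0]; linarith
  have hOq : Ω * q * (1 - p) = ε := by
    rw [mul_assoc, hqm, hp']; field_simp; ring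
  have w0 : 0 ≤ Ω * q := by positivity
  have hw : Ω * q ≤ 1.002 * ε := by nlinarith
  have X0 := h.big
  have X3 := h.cube_le
  have hcard : Q E p' x (fun n => (n : ℝ)) ≤ Fintype.card V := by
    have : Q E p' x (fun n => (n : ℝ)) ≤ Ex E p' (fun _ => (Fintype.card V : ℝ)) :=
      Ex_mono (by linarith) hp1 fun S _ => Nat.cast_le.2 (Finset.card_le_univ (cl S x))
    rwa [Ex_const] at this
  have Y0 : 0 ≤ Q E p' x (fun n => (n : ℝ)) :=
    Q_nonneg (by linarith) hp1 x (fun n => Nat.cast_nonneg n)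
  have hi := spr_i h.tr p0.le p1.le q0 q1 x
  rw [hpp] at hi
  have hii := fun (γ : ℝ) (g0 : 0 ≤ γ) (g1 : γ ≤ 1) => spr_ii h.tr p0.le p1.le q0 q1 g0 g1 x
  have hiii := fun (γ : ℝ) (g0 : 0 < γ) (g1 : γ ≤ 1) => spr_iii h.tr p0.le p1.le q0 q1 g0 g1 x
  rw [hpp] at hii hiii
  set X := Q E p x (fun n => (n : ℝ)) with hX
  set Y := Q E p' x (fun n => (n : ℝ)) with hY
  set n : ℝ := (Fintype.card V : ℝ) with hn
  set w := Ω * q with hwdef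
  have n0 : 0 ≤ n := Nat.cast_nonneg _
  by_cases c1 : 1 / 9 ≤ ε
  · have : 1 / 81 ≤ ε ^ 2 := by nlinarith
    nlinarith [mul_le_mul_of_nonneg_right this n0]
  push Not at c1
  by_cases c2 : 2 * ε * X < 1
  · have : X * (w * Y) ≤ 0.51 * Y := by
      have : X * w ≤ 0.51 := by nlinarith
      nlinarith
    have : 0 ≤ ε ^ 2 * n := by positivity
    nlinarith
  push Not at c2
  have ε0 : 0 < ε := by
    rcases e0.eq_or_lt with h0 | h0
    · rw [← h0] at c2; norm_num at c2
    · exact h0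
  set s := 1.5 * ε with hs
  have s0 : 0 < s := by positivity
  have s1 : s ^ 2 ≤ 3 / 100 := by nlinarith
  have g0 : 0 < s ^ 2 := by positivity
  have hD := h.D_bound s0 s1
  have hM := h.sq_bound g0.le s1
  specialize hii (s ^ 2) g0.le (by linarith)
  specialize hiii (s ^ 2) g0 (by linarith)
  have M0 : 0 ≤ Q E p x (phi (s^2)) := Q_nonneg h.p0.le h.p1.le x (phi_nonneg g0.le (by linarith))
  have M0' : 0 ≤ Q E p' x (phi (s^2)) :=
    Q_nonneg (by linarith) hp1 x (phi_nonneg g0.le (by linarith))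
  have D0 : 0 ≤ Q E p x (fn (s^2)) := Q_nonneg h.p0.le h.p1.le x (fn_nonneg (by linarith))
  set M := Q E p x (phi (s^2))
  set M' := Q E p' x (phi (s^2))
  set D := Q E p x (fn (s^2))
  have hu : D * w ≤ 0.49 := by
    have a := mul_le_mul_of_nonneg_left hw D0
    have b : D * (1.002 * ε) = 0.668 * (s * D) := by rw [hs]; ring
    linarith
  have hu' : D * (w * M') ≤ 0.49 * M' := by
    rw [← mul_assoc]; exact mul_le_mul_of_nonneg_right hu M0'
  have hM' : M' ≤ 2 * M := by linarith
  have t1 : D * (w * Y) ≤ 0.49 * Y := by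
    rw [← mul_assoc]; exact mul_le_mul_of_nonneg_right hu Y0
  have t2 : n * (M * M') ≤ n * (13.5 * ε ^ 2) := by
    refine mul_le_mul_of_nonneg_left ?_ n0
    have a := mul_le_mul_of_nonneg_left hM' M0
    have b : M * (2 * M) = 2 * M ^ 2 := by ring
    have c : s ^ 2 = 2.25 * ε ^ 2 := by rw [hs]; ring
    linarith
  have hMs : M ≤ 1.7321 * s := by
    refine (pow_le_pow_iff_left₀ M0 (by positivity) two_ne_zero).1 ?_
    have c : (1.7321 * s) ^ 2 = 3.00017041 * s ^ 2 := by ring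
    linarith
  have t3 : X * (w * (M' / s ^ 2)) ≤ X * 2.35 := by
    refine mul_le_mul_of_nonneg_left ?_ (by linarith)
    rw [← mul_div_assoc, div_le_iff₀ g0]
    have a1 : w * M' ≤ 1.002 * ε * (2 * (1.7321 * s)) :=
      mul_le_mul hw (by linarith) M0' (by positivity)
    have a2 : 1.002 * ε * (2 * (1.7321 * s)) = 1.002 * 2 * 1.7321 / 1.5 * s ^ 2 := by
      rw [hs]; ring
    have a3 : 1.002 * 2 * 1.7321 / 1.5 * s ^ 2 ≤ 2.35 * s ^ 2 := by
      refine mul_le_mul_of_nonneg_right ?_ g0.le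
      norm_num
    linarith
  have t4 : 0.51 * Y ≤ 3.35 * X + 13.5 * (ε ^ 2 * n) := by linarith
  have t5 : 0 ≤ ε ^ 2 * n := by positivity
  linarith

end core
end PercAux

namespace PercAux
set_option linter.unusedSectionVars false

section bridge
variable {V : Type*} [Fintype V] [DecidableEq V]
open Percolation

/-- the bond set as a finset -/
def bonds (G : SimpleGraph V) : Finset (Sym2 V) :=
  (Finset.univ : Finset G.edgeSet).map (Function.Embedding.subtype _)

lemma mem_bonds {G : SimpleGraph V} {e : Sym2 V} : e ∈ bonds G ↔ e ∈ G.edgeSet := by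
  simp [bonds]

/-- the occupied bonds of a configuration -/
def occ (G : SimpleGraph V) (ω : Config G) : Finset (Sym2 V) :=
  ((Finset.univ : Finset G.edgeSet).filter (fun e => ω e = true)).map
    (Function.Embedding.subtype _)

lemma prod_aux {ι : Type*} [Fintype ι] (p : ℝ) (ω : ι → Bool) :
    (∏ e : ι, if ω e then p else 1 - p) =
      p ^ ((Finset.univ : Finset ι).filter (fun e => ω e = true)).card *
      (1 - p) ^ ((Finset.univ : Finset ι).card -
        ((Finset.univ : Finset ι).filter (fun e => ω e = true)).card) := by
  rw [Finset.prod_ite, Finset.prod_const, Finset.prod_const]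
  congr 2
  have := Finset.card_filter_add_card_filter_not (s := (Finset.univ : Finset ι))
    (fun e => ω e = true)
  omega

lemma weight_eq (G : SimpleGraph V) (p : ℝ) (ω : Config G) :
    weight G p ω = p ^ ((Finset.univ : Finset G.edgeSet).filter (fun e => ω e = true)).card *
      (1 - p) ^ ((Finset.univ : Finset G.edgeSet).card -
        ((Finset.univ : Finset G.edgeSet).filter (fun e => ω e = true)).card) := by
  unfold weight
  refine Eq.trans ?_ ((prod_aux (ι := G.edgeSet) p ω).trans ?_)
  · refine Finset.prod_congr rfl fun e _ => ?_
    split_ifs <;> rfl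
  · congr!

lemma expect_eq (G : SimpleGraph V) (p : ℝ) (f : Finset (Sym2 V) → ℝ) :
    expect G p (fun ω => f (occ G ω)) = Ex (bonds G) p f := by
  unfold bonds
  rw [Ex_map]
  unfold expect Ex
  refine Finset.sum_bij' (fun ω _ => (Finset.univ : Finset G.edgeSet).filter (fun e => ω e = true))
    (fun S _ => (fun e => decide (e ∈ S) : G.edgeSet → Bool)) ?_ ?_ ?_ ?_ ?_
  · intro ω _; simp
  · intro S _; exact Finset.mem_univ _
  · intro ω _
    funext e
    simp
  · intro S _
    ext e
    simp
  · intro ω _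
    rw [weight_eq]
    rfl

lemma occupied_eq (G : SimpleGraph V) (ω : Config G) : occupied G ω = gr (occ G ω) := by
  unfold occupied gr
  congr 1
  ext e
  simp [occ]

lemma chi_eq (G : SimpleGraph V) (x : V) (p : ℝ) :
    chi G x p = Q (bonds G) p x (fun n => (n : ℝ)) := by
  unfold Q
  rw [← expect_eq]
  unfold chi
  congr 1
  ext ω
  congr 2
  ext y
  rw [mem_cl, ← occupied_eq]
  simp [cluster]

lemma tau_eq (G : SimpleGraph V) (p : ℝ) (x y : V) :
    Percolation.tau G p x y = PercAux.tau (bonds G) p x y := by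
  unfold PercAux.tau
  rw [← expect_eq]
  unfold Percolation.tau prob expect
  refine Finset.sum_congr rfl fun ω _ => ?_
  have : y ∈ cl (occ G ω) x ↔ (occupied G ω).Reachable x y := by rw [mem_cl, ← occupied_eq]
  beta_reduce
  by_cases h : (occupied G ω).Reachable x y
  · rw [ind_true (this.2 h), if_pos h, mul_one]
  · rw [ind_false (fun h' => h (this.1 h')), if_neg h, mul_zero]

lemma triangle_eq (G : SimpleGraph V) (p : ℝ) (x y : V) :
    triangle G p x y = tri (bonds G) p x y := by
  unfold triangle tri
  simp only [tau_eq]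

lemma trReg_bonds (G : SimpleGraph V) [DecidableRel G.Adj] {Ω : ℕ} (h1 : IsTransitive G)
    (h2 : G.IsRegularOfDegree Ω) : TrReg (bonds G) Ω where
  reg w := by
    rw [← h2 w, ← SimpleGraph.card_neighborFinset_eq_degree]
    congr 1
    ext y
    simp [mem_bonds]
  loop w := by simp [mem_bonds]
  trans x y := by
    obtain ⟨φ, hφ⟩ := h1 x y
    refine ⟨φ.toEquiv, fun a b => ?_, hφ⟩
    simp only [mem_bonds, SimpleGraph.mem_edgeSet]
    exact (φ.map_rel_iff (a := a) (b := b)).symm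

end bridge
end PercAux

open Percolation in
/-- Theorem 1.4(ii) (Supercritical phase): upper bound on the supercritical
susceptibility. -/
theorem supercritical_susceptibility :
    ∃ b₀ : ℝ, 0 < b₀ ∧
      ∀ (V : Type) [Fintype V] [DecidableEq V]
        (G : SimpleGraph V) [DecidableRel G.Adj],
        G.Connected → IsTransitive G →
        ∀ Ω : ℕ, G.IsRegularOfDegree Ω →
        ∀ (x₀ : V) (lam : ℝ), 0 < lam →
        1 < lam * (Fintype.card V : ℝ) ^ ((1 : ℝ) / 3) →
        lam * (Fintype.card V : ℝ) ^ ((1 : ℝ) / 3) < (Fintype.card V : ℝ) →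
        b₀⁻¹ ≤ lam * (Fintype.card V : ℝ) ^ ((1 : ℝ) / 3) →
        ∀ pc : ℝ, 0 < pc → pc < 1 →
        chi G x₀ pc = lam * (Fintype.card V : ℝ) ^ ((1 : ℝ) / 3) →
        ∀ a₀ : ℝ, a₀ ≤ b₀ →
        (∀ x y : V, triangle G pc x y ≤ kron x y + a₀) →
        ∀ ε : ℝ, 0 ≤ ε →
        ∀ p : ℝ, p = pc + ε * (Ω : ℝ)⁻¹ → p ≤ 1 →
          chi G x₀ p ≤
            81 * ((Fintype.card V : ℝ) ^ ((1 : ℝ) / 3) +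
              ε ^ 2 * (Fintype.card V : ℝ)) := by
  refine ⟨1 / 1000, by norm_num, ?_⟩
  intro V _ _ G _ _ htr Ω hreg x₀ lam hlam _ _ hbig pc hpc0 hpc1 hchi a₀ ha₀ htri ε hε p hp hp1
  have hc : PercAux.Crit (PercAux.bonds G) Ω pc x₀ := by
    refine ⟨PercAux.trReg_bonds G htr hreg, hpc0, hpc1, ?_, fun x y => ?_⟩
    · rw [← PercAux.chi_eq, hchi]
      norm_num at hbig
      norm_num
      exact hbig
    · have h := htri x y
      rw [PercAux.triangle_eq] at h
      have hk : kron x y = if x = y then (1 : ℝ) else 0 := by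
        unfold kron
        split_ifs <;> rfl
      rw [hk] at h
      split_ifs at h ⊢ <;> linarith
  have hcore := hc.core hε hp hp1
  have hcube := hc.cube_le
  rw [← PercAux.chi_eq, ← PercAux.chi_eq] at hcore
  rw [← PercAux.chi_eq] at hcube
  have hV : (0 : ℝ) ≤ (Fintype.card V : ℝ) := Nat.cast_nonneg _
  have hroot : ((Fintype.card V : ℝ) ^ ((1 : ℝ) / 3)) ^ 3 = (Fintype.card V : ℝ) := by
    rw [← Real.rpow_natCast, ← Real.rpow_mul hV]
    norm_num
  have hchi0 : 0 ≤ (Fintype.card V : ℝ) ^ ((1 : ℝ) / 3) := Real.rpow_nonneg hV _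
  have hle : chi G x₀ pc ≤ (Fintype.card V : ℝ) ^ ((1 : ℝ) / 3) := by
    refine (pow_le_pow_iff_left₀ (by rw [hchi]; positivity) hchi0 three_ne_zero).1 ?_
    rw [hroot]
    linarith
  linarith
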